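/- Let K, L ⊊ H² be proper closed convex sets with nonempty interior such that for all orientation-preserving congruences φ, ψ of H² with int((φK) ∩ (ψL)) ≠ ∅, the set (φK) ∩ (ψL) admits some non-trivial congruence. Suppose K is a circle of radius r and centre o, and the connected boundary components of L are at least two hypercycles or straight lines. Then case (B) or case (C) holds: either L is bounded by two hypercycles whose base lines coincide, or by a hypercycle and its base line; or L is bounded by at least two hypercycles or straight lines (with all base lines different) whose mutual distances are at least 2r. -/

import Mathlib

open Metric Set Filter

namespace BallChar

/-- `X` is (isometric to) the `d`-dimensional round sphere of radius 1,
with the intrinsic (great-circle) metric. -/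
def IsSphereSpace (X : Type*) [MetricSpace X] (d : ℕ) : Prop :=
  ∃ e : X → EuclideanSpace ℝ (Fin (d + 1)),
    Function.Injective e ∧
    Set.range e = Metric.sphere (0 : EuclideanSpace ℝ (Fin (d + 1))) 1 ∧
    ∀ x y : X, dist x y = Real.arccos (@inner ℝ _ _ (e x) (e y))

/-- `X` is (isometric to) the `d`-dimensional Euclidean space. -/
def IsEuclideanSpaceForm (X : Type*) [MetricSpace X] (d : ℕ) : Prop :=
  Nonempty (X ≃ᵢ EuclideanSpace ℝ (Fin d))

/-- The Minkowski bilinear form on `ℝ^d × ℝ`. -/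
noncomputable def mink (d : ℕ) (u v : EuclideanSpace ℝ (Fin d) × ℝ) : ℝ :=
  @inner ℝ _ _ u.1 v.1 - u.2 * v.2

/-- `X` is (isometric to) the `d`-dimensional hyperbolic space of curvature `-1`
(the hyperboloid model). -/
def IsHyperbolicSpace (X : Type*) [MetricSpace X] (d : ℕ) : Prop :=
  ∃ e : X → EuclideanSpace ℝ (Fin d) × ℝ,
    Function.Injective e ∧
    Set.range e = {u | mink d u u = -1 ∧ 0 < u.2} ∧
    ∀ x y : X, Real.cosh (dist x y) = - mink d (e x) (e y)

/-- `X` is `S^d`, `ℝ^d` or `H^d`. -/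
def IsSpaceForm (X : Type*) [MetricSpace X] (d : ℕ) : Prop :=
  IsSphereSpace X d ∨ IsEuclideanSpaceForm X d ∨ IsHyperbolicSpace X d

variable {X : Type*} [MetricSpace X]

/-- Metric betweenness: `z` lies on a shortest geodesic from `x` to `y`. -/
def Btw (x z y : X) : Prop := dist x z + dist z y = dist x y

/-- `z` is the unique point between `x` and `y` at its distance from `x`. -/
def UniqueBtwPt (x z y : X) : Prop :=
  Btw x z y ∧ ∀ w, Btw x w y → dist x w = dist x z → w = z

/-- Geodesic convexity (for two antipodal points of a sphere no condition is imposed). -/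
def GConvex (K : Set X) : Prop :=
  ∀ x ∈ K, ∀ y ∈ K, ∀ z, UniqueBtwPt x z y → z ∈ K

/-- `p` is a (metric) midpoint of `x` and `y`. -/
def IsMidpoint (p x y : X) : Prop := Btw x p y ∧ dist x p = dist p y

/-- A reflection in a hyperplane: a non-trivial involutive isometry whose
non-fixed locus is disconnected (by the mirror hyperplane). -/
def IsReflection (σ : X ≃ᵢ X) : Prop :=
  σ.trans σ = IsometryEquiv.refl X ∧ σ ≠ IsometryEquiv.refl X ∧
    ¬ IsPreconnected {x : X | σ x ≠ x}

/-- An orientation preserving congruence: a product of an even number of reflections. -/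
def OrientationPreserving (f : X ≃ᵢ X) : Prop :=
  ∃ l : List (X ≃ᵢ X), (∀ σ ∈ l, IsReflection σ) ∧ Even l.length ∧
    f = l.foldr IsometryEquiv.trans (IsometryEquiv.refl X)

/-- Two subsets are congruent if some isometry of the space maps one onto the other. -/
def Congruent (A B : Set X) : Prop := ∃ f : X ≃ᵢ X, ⇑f '' A = B

/-- `S` admits some non-trivial congruence. -/
def AdmitsNontrivialCongruence (S : Set X) : Prop :=
  ∃ f : X ≃ᵢ X, f ≠ IsometryEquiv.refl X ∧ ⇑f '' S = S

/-- `S` is axially symmetric (symmetric with respect to some reflection). -/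
def AxiallySymmetric (S : Set X) : Prop :=
  ∃ σ : X ≃ᵢ X, IsReflection σ ∧ ⇑σ '' S = S

/-- `S` is centrally symmetric: some involutive isometry fixing a point `p`
maps `S` onto itself, `p` being a midpoint of every pair `x`, `σ x` of `S`. -/
def CentrallySymmetric (S : Set X) : Prop :=
  ∃ (σ : X ≃ᵢ X) (p : X), Function.Involutive ⇑σ ∧ σ p = p ∧ ⇑σ '' S = S ∧
    ∀ x ∈ S, IsMidpoint p x (σ x)

/-- `S` is symmetric with respect to the orthogonal bisector hyperplane of
the segment `[a, b]`, i.e. invariant under the reflection interchanging `a` and `b`. -/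
def SymmetricWrtPerpBisector (S : Set X) (a b : X) : Prop :=
  ∃ σ : X ≃ᵢ X, IsReflection σ ∧ σ a = b ∧ ⇑σ '' S = S

/-- A closed half-space: one of the two closed sides of the mirror of a reflection. -/
def IsHalfspace (P : Set X) : Prop :=
  ∃ σ : X ≃ᵢ X, IsReflection σ ∧ IsClosed P ∧
    P ∪ ⇑σ '' P = univ ∧ P ∩ ⇑σ '' P = {x | σ x = x}

/-- A hyperplane: the mirror (fixed point set) of a reflection. -/
def IsHyperplane (B : Set X) : Prop :=
  ∃ σ : X ≃ᵢ X, IsReflection σ ∧ B = {x | σ x = x}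

/-- A paraball (horoball): a sublevel set of a Busemann function. -/
def IsParaball (K : Set X) : Prop :=
  ∃ γ : ℝ → X, Isometry γ ∧
    K = {x | ∃ b ≤ 0, Tendsto (fun t => dist x (γ t) - t) atTop (nhds b)}

/-- A parasphere (horosphere): the boundary of a paraball. -/
def IsParasphere (C : Set X) : Prop := ∃ K : Set X, IsParaball K ∧ C = frontier K

/-- A hypersphere at distance `lam > 0` from its base hyperplane
(degeneration to a hyperplane excluded). -/
def IsHypersphere (C : Set X) (lam : ℝ) : Prop :=
  0 < lam ∧ (∃ P : Set X, IsHalfspace P ∧ C = frontier {x | infDist x P ≤ lam}) ∧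
    ¬ IsHyperplane C

/-- The family of connected components of the boundary of `K`. -/
def bdryComponents (K : Set X) : Set (Set X) :=
  (connectedComponentIn (frontier K)) '' (frontier K)

/-- `closedBall p r` is an inball of `M` (a ball of maximal radius contained in `M`). -/
def IsInball (M : Set X) (p : X) (r : ℝ) : Prop :=
  0 ≤ r ∧ closedBall p r ⊆ M ∧ ∀ (q : X) (s : ℝ), closedBall q s ⊆ M → s ≤ r

/-- `closedBall p r` is the unique inball of `M`. -/
def HasUniqueInball (M : Set X) (p : X) (r : ℝ) : Prop :=
  IsInball M p r ∧ ∀ (q : X) (s : ℝ), IsInball M q s → q = p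

/-- The (geodesic) convex hull of a set. -/
def gconvexHull (Y : Set X) : Set X := ⋂₀ {C : Set X | GConvex C ∧ Y ⊆ C}

/-- `z` lies on the complete geodesic line through `a` and `b`. -/
def OnLine (a b z : X) : Prop := Btw a z b ∨ Btw z a b ∨ Btw a b z

/-- The closed `(d-1)`-ball of radius `ε` centred at `a` in the hyperplane through `a`
orthogonal to the segment `[a, b]`. -/
def perpDisc (a b : X) (ε : ℝ) : Set X :=
  {x | (∀ z, OnLine a b z → dist x a ≤ dist x z) ∧ dist x a ≤ ε}

/-- The set `D(ε)` associated to the segment `D = [a, b]`: the convex hull of the two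
`(d-1)`-balls of radius `ε` orthogonal to `D` at its endpoints. -/
def segCyl (a b : X) (ε : ℝ) : Set X :=
  gconvexHull (perpDisc a b ε ∪ perpDisc b a ε)

/-- `[a, b]` is the unique diametral segment of `M`. -/
def UniqueDiametral (M : Set X) (a b : X) : Prop :=
  a ∈ M ∧ b ∈ M ∧ a ≠ b ∧ dist a b = diam M ∧
    ∀ a' ∈ M, ∀ b' ∈ M, dist a' b' = diam M → (a' = a ∧ b' = b) ∨ (a' = b ∧ b' = a)

/-- Condition (**): at every boundary point, `K` contains a ball having this point
on its boundary. -/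
def CondBallInside (K : Set X) : Prop :=
  ∀ x ∈ frontier K, ∃ ε > 0, ∃ p : X, closedBall p ε ⊆ K ∧ x ∈ sphere p ε

/-- `K` has an extreme point. -/
def HasExtremePoint (K : Set X) : Prop :=
  ∃ x ∈ K, ∀ y ∈ K, ∀ z ∈ K, Btw y x z → x = y ∨ x = z

/-- Condition (***): near every boundary point, `K` is contained in a ball
(resp. in a convex set bounded by a hypersphere, for hyperbolic space) whose boundary
has sectional curvatures bounded below and passes through the given point. -/
def CondCurvBound (d : ℕ) (K : Set X) : Prop :=
  ∀ x ∈ frontier K, ∃ ε > 0, ∃ B : Set X,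
    {y | y ∈ K ∧ dist y x ≤ ε} ⊆ B ∧ x ∈ frontier B ∧
    (IsSphereSpace X d → ∃ (q : X) (R : ℝ), 0 < R ∧ R < Real.pi / 2 ∧
        ε ≤ Real.cos R / Real.sin R ∧ B = closedBall q R) ∧
    (IsEuclideanSpaceForm X d → ∃ (q : X) (R : ℝ), 0 < R ∧ ε ≤ 1 / R ∧ B = closedBall q R) ∧
    (IsHyperbolicSpace X d → ∃ (P : Set X) (lam : ℝ), IsHalfspace P ∧ 0 < lam ∧
        ε ≤ Real.tanh lam ∧ B = {y | infDist y P ≤ lam})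

/-- `K` has a supporting sphere at each of its boundary points
(for the sphere, of radius less than `π/2`). -/
def SupportingSpheres (d : ℕ) (K : Set X) : Prop :=
  ∀ x ∈ frontier K, ∃ (p : X) (R : ℝ), 0 < R ∧ K ⊆ closedBall p R ∧ x ∈ sphere p R ∧
    (IsSphereSpace X d → R < Real.pi / 2)

/-- `K` is `C¹` (smooth): at each boundary point there is a unique supporting half-space. -/
def SmoothBody (K : Set X) : Prop :=
  ∀ x ∈ frontier K, ∃! P : Set X, IsHalfspace P ∧ K ⊆ P ∧ x ∈ frontier P

/-- A complete geodesic (straight line). -/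
def IsGeodesicLine (B : Set X) : Prop := ∃ γ : ℝ → X, Isometry γ ∧ B = Set.range γ

/-- A circle (closed disc) of positive radius. -/
def IsDisc (K : Set X) : Prop := ∃ (p : X) (r : ℝ), 0 < r ∧ K = closedBall p r

/-- The parallel domain of `B` at distance `l`. -/
def parallelDomain (B : Set X) (l : ℝ) : Set X := {x | infDist x B ≤ l}

/-- `K` is the parallel domain of some straight line, at some distance `l > 0`. -/
def IsParallelDomain (K : Set X) : Prop :=
  ∃ (B : Set X) (l : ℝ), IsGeodesicLine B ∧ 0 < l ∧ K = parallelDomain B l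

/-- A convex domain bounded by a (proper) hypercycle. -/
def IsHypercycleDomain (K : Set X) : Prop :=
  ∃ (P : Set X) (l : ℝ), IsHalfspace P ∧ 0 < l ∧ K = {x | infDist x P ≤ l}

/-- `C` is a hypercycle or a straight line (a curve at constant distance `l ≥ 0`
from its base line). -/
def IsHypercycleOrLine (C : Set X) : Prop :=
  ∃ (P : Set X) (l : ℝ), IsHalfspace P ∧ 0 ≤ l ∧ C = frontier {x | infDist x P ≤ l}

/-- `C` is a hypercycle (or straight line) with base line `B`. -/
def HypercycleWithBase (C B : Set X) : Prop :=
  ∃ (P : Set X) (l : ℝ), IsHalfspace P ∧ 0 ≤ l ∧ frontier P = B ∧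
    C = frontier {x | infDist x P ≤ l}


/-! Cases (A)-(E) of Theorem 5 (hyperbolic plane). -/

/-- One of the basic bodies of case (A). -/
def CaseABody (K : Set X) : Prop :=
  IsDisc K ∨ IsParaball K ∨ IsHypercycleDomain K ∨ IsHalfspace K

/-- Case (A) of Theorem 5. -/
def CaseA (K L : Set X) : Prop :=
  CaseABody K ∧ CaseABody L ∧
    ((IsHypercycleDomain K ∨ IsHalfspace K) → IsDisc L ∨ Congruent K L) ∧
    ((IsHypercycleDomain L ∨ IsHalfspace L) → IsDisc K ∨ Congruent L K)

/-- `M` is bounded either by two hypercycles whose base lines coincide, or by a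
hypercycle and its base line. -/
def TwoHypSameBase (M : Set X) : Prop :=
  ∃ (B C₁ C₂ : Set X), IsGeodesicLine B ∧ C₁ ≠ C₂ ∧
    HypercycleWithBase C₁ B ∧ HypercycleWithBase C₂ B ∧ frontier M = C₁ ∪ C₂

/-- Case (B) of Theorem 5. -/
def CaseB (K L : Set X) : Prop :=
  (IsDisc K ∧ TwoHypSameBase L) ∨ (IsDisc L ∧ TwoHypSameBase K)

/-- `M` is bounded by at least two hypercycles or straight lines, with all base lines
different, whose mutual distances are at least `2r`. -/
def MultiHypFarApart (M : Set X) (r : ℝ) : Prop :=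
  (∀ x ∈ frontier M, IsHypercycleOrLine (connectedComponentIn (frontier M) x)) ∧
  (∃ x ∈ frontier M, ∃ y ∈ frontier M,
      connectedComponentIn (frontier M) x ≠ connectedComponentIn (frontier M) y) ∧
  (∀ x ∈ frontier M, ∀ y ∈ frontier M,
      connectedComponentIn (frontier M) x ≠ connectedComponentIn (frontier M) y →
        2 * r ≤ dist x y ∧
        ∀ B₁ B₂ : Set X, HypercycleWithBase (connectedComponentIn (frontier M) x) B₁ →
          HypercycleWithBase (connectedComponentIn (frontier M) y) B₂ → B₁ ≠ B₂)

/-- Case (C) of Theorem 5. -/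
def CaseC (K L : Set X) : Prop :=
  (∃ (p : X) (r : ℝ), 0 < r ∧ K = closedBall p r ∧ MultiHypFarApart L r) ∨
  (∃ (p : X) (r : ℝ), 0 < r ∧ L = closedBall p r ∧ MultiHypFarApart K r)

/-- Case (D) of Theorem 5. -/
def CaseD (K L : Set X) : Prop :=
  (IsParaball K ∧ IsParallelDomain L) ∨ (IsParaball L ∧ IsParallelDomain K)

/-- Case (E) of Theorem 5. -/
def CaseE (K L : Set X) : Prop :=
  Congruent K L ∧ IsParallelDomain K ∧ IsParallelDomain L

/-- All cases of (3) of Theorem 5 together. -/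
def Theorem5Cases (K L : Set X) : Prop :=
  CaseA K L ∨ CaseB K L ∨ CaseC K L ∨ CaseD K L ∨ CaseE K L

/-- Condition (1) of Theorem 5: every intersection of congruent copies admits some
non-trivial congruence. -/
def T5Cond1 (K L : Set X) : Prop :=
  ∀ φ ψ : X ≃ᵢ X, OrientationPreserving φ → OrientationPreserving ψ →
    (interior ((⇑φ '' K) ∩ (⇑ψ '' L))).Nonempty →
    AdmitsNontrivialCongruence ((⇑φ '' K) ∩ (⇑ψ '' L))

/-- Condition (2) of Theorem 5: every intersection of congruent copies is axially
symmetric. -/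
def T5Cond2 (K L : Set X) : Prop :=
  ∀ φ ψ : X ≃ᵢ X, OrientationPreserving φ → OrientationPreserving ψ →
    (interior ((⇑φ '' K) ∩ (⇑ψ '' L))).Nonempty →
    AxiallySymmetric ((⇑φ '' K) ∩ (⇑ψ '' L))

/-- All connected components of the boundary of `K` are hypercycles or straight lines. -/
def BdryHypOrLine (K : Set X) : Prop :=
  ∀ x ∈ frontier K, IsHypercycleOrLine (connectedComponentIn (frontier K) x)

/-- The boundary of `K` has at least two connected components. -/
def AtLeastTwoComponents (K : Set X) : Prop :=
  ∃ x ∈ frontier K, ∃ y ∈ frontier K,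
    connectedComponentIn (frontier K) x ≠ connectedComponentIn (frontier K) y

/-- The boundary of `K` is nonempty and has a single connected component. -/
def SingleComponent (K : Set X) : Prop :=
  (frontier K).Nonempty ∧ ∀ x ∈ frontier K, ∀ y ∈ frontier K,
    connectedComponentIn (frontier K) x = connectedComponentIn (frontier K) y

/-- The associated graph of `K` contains two edges with at least one common endpoint:
`K` has two distinct boundary components which are asymptotic (come arbitrarily close). -/
def TwoAsymptoticComponents (K : Set X) : Prop :=
  ∃ x ∈ frontier K, ∃ y ∈ frontier K,
    connectedComponentIn (frontier K) x ≠ connectedComponentIn (frontier K) y ∧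
    ∀ δ > (0 : ℝ), ∃ p ∈ connectedComponentIn (frontier K) x,
      ∃ q ∈ connectedComponentIn (frontier K) y, dist p q < δ

/-- The associated graph of `K` has only pairwise vertex-disjoint edges: distinct
boundary components of `K` stay at positive distance from each other. -/
def VertexDisjointEdges (K : Set X) : Prop :=
  ∀ x ∈ frontier K, ∀ y ∈ frontier K,
    connectedComponentIn (frontier K) x ≠ connectedComponentIn (frontier K) y →
      ∃ δ > (0 : ℝ), ∀ p ∈ connectedComponentIn (frontier K) x,
        ∀ q ∈ connectedComponentIn (frontier K) y, δ ≤ dist p q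

/-! Conditions of Theorem 6. -/

/-- Condition (1) of Theorem 6. -/
def T6Cond1 (K L : Set X) : Prop :=
  ∃ ε > (0 : ℝ), ∀ φ ψ : X ≃ᵢ X, OrientationPreserving φ → OrientationPreserving ψ →
    (interior ((⇑φ '' K) ∩ (⇑ψ '' L))).Nonempty →
    diam ((⇑φ '' K) ∩ (⇑ψ '' L)) < ε →
    CentrallySymmetric ((⇑φ '' K) ∩ (⇑ψ '' L))

/-- Condition (2) of Theorem 6. -/
def T6Cond2 (K L : Set X) : Prop :=
  ∀ x ∈ frontier K, ∀ y ∈ frontier L, ∃ ε > (0 : ℝ),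
    ∀ φ ψ : X ≃ᵢ X, OrientationPreserving φ → OrientationPreserving ψ →
      (interior ((⇑φ '' K) ∩ (⇑ψ '' L))).Nonempty →
      diam ((⇑φ '' K) ∩ (⇑ψ '' L)) < ε →
      ∀ (p : X) (r : ℝ), HasUniqueInball ((⇑φ '' K) ∩ (⇑ψ '' L)) p r →
        frontier ((⇑φ '' K) ∩ (⇑ψ '' L)) ∩ sphere p r = {φ x, ψ y} →
        φ x ∈ interior (⇑ψ '' L) → ψ y ∈ interior (⇑φ '' K) →
        IsMidpoint p (φ x) (ψ y) →
        CentrallySymmetric ((⇑φ '' K) ∩ (⇑ψ '' L))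

/-- Condition (3) of Theorem 6. -/
def T6Cond3 (K L : Set X) : Prop :=
  ∀ x ∈ frontier K, ∀ y ∈ frontier L, ∃ ε > (0 : ℝ),
    ∀ φ ψ : X ≃ᵢ X, OrientationPreserving φ → OrientationPreserving ψ →
      (interior ((⇑φ '' K) ∩ (⇑ψ '' L))).Nonempty →
      diam ((⇑φ '' K) ∩ (⇑ψ '' L)) < ε →
      ∀ (p : X) (r : ℝ), HasUniqueInball ((⇑φ '' K) ∩ (⇑ψ '' L)) p r →
        frontier ((⇑φ '' K) ∩ (⇑ψ '' L)) ∩ sphere p r = {φ x, ψ y} →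
        φ x ∈ interior (⇑ψ '' L) → ψ y ∈ interior (⇑φ '' K) →
        IsMidpoint p (φ x) (ψ y) →
        SymmetricWrtPerpBisector ((⇑φ '' K) ∩ (⇑ψ '' L)) (φ x) (ψ y)

/-- Condition (4) of Theorem 6. -/
def T6Cond4 (d : ℕ) (K L : Set X) : Prop :=
  (∃ r > (0 : ℝ), (IsSphereSpace X d → r ≤ Real.pi / 2) ∧
      (∀ C ∈ bdryComponents K ∪ bdryComponents L, ∃ p : X, C = sphere p r) ∧
      (∃ p : X, K = closedBall p r) ∧ ∃ q : X, L = closedBall q r) ∨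
  ((∀ C ∈ bdryComponents K ∪ bdryComponents L, IsParasphere C) ∧
      IsParaball K ∧ IsParaball L) ∨
  (∃ lam > (0 : ℝ), ∀ C ∈ bdryComponents K ∪ bdryComponents L, IsHypersphere C lam)

/-! Conditions of Theorems 7 and 8. -/

/-- The pair `φ, ψ` is admissible for hypothesis (****): both are orientation
preserving, and for the sphere `(φ K) ∪ (ψ L)` lies in an open hemisphere. -/
def GoodPair (d : ℕ) (K L : Set X) (φ ψ : X ≃ᵢ X) : Prop :=
  OrientationPreserving φ ∧ OrientationPreserving ψ ∧
    (IsSphereSpace X d → ∃ s : X, (⇑φ '' K) ∪ (⇑ψ '' L) ⊆ ball s (Real.pi / 2))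

/-- The convex hull of the union of the two congruent copies. -/
def hullUnion (K L : Set X) (φ ψ : X ≃ᵢ X) : Set X := gconvexHull ((⇑φ '' K) ∪ (⇑ψ '' L))

/-- Condition (A) of (3) of Theorem 7: the diameter of `M` is sufficiently close to `π`
(sphere), resp. sufficiently large (Euclidean, hyperbolic), as measured by `δ`. -/
def BigDiam (d : ℕ) (X : Type*) [MetricSpace X] (M : Set X) (δ : ℝ) : Prop :=
  (IsSphereSpace X d → Real.pi - δ < diam M) ∧ (¬ IsSphereSpace X d → 1 / δ < diam M)

/-- Condition (1) of Theorem 7. -/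
def T7Cond1 (d : ℕ) (K L : Set X) : Prop :=
  ∀ φ ψ : X ≃ᵢ X, GoodPair d K L φ ψ → CentrallySymmetric (hullUnion K L φ ψ)

/-- Condition (2) of Theorem 7. -/
def T7Cond2 (d : ℕ) (K L : Set X) : Prop :=
  ∀ φ ψ : X ≃ᵢ X, GoodPair d K L φ ψ → ∀ a b : X, UniqueDiametral (hullUnion K L φ ψ) a b →
    SymmetricWrtPerpBisector (hullUnion K L φ ψ) a b

/-- Condition (3) of Theorem 7. -/
def T7Cond3 (d : ℕ) (K L : Set X) : Prop :=
  ∃ δ > (0 : ℝ), ∀ φ ψ : X ≃ᵢ X, GoodPair d K L φ ψ →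
    ∀ x ∈ frontier K, ∀ y ∈ frontier L,
      BigDiam d X (hullUnion K L φ ψ) δ →
      UniqueDiametral (hullUnion K L φ ψ) (φ x) (ψ y) →
      CentrallySymmetric (hullUnion K L φ ψ)

/-- Condition (4) of Theorem 7. -/
def T7Cond4 (d : ℕ) (K L : Set X) : Prop :=
  ∃ δ > (0 : ℝ), ∀ φ ψ : X ≃ᵢ X, GoodPair d K L φ ψ →
    ∀ x ∈ frontier K, ∀ y ∈ frontier L,
      BigDiam d X (hullUnion K L φ ψ) δ →
      UniqueDiametral (hullUnion K L φ ψ) (φ x) (ψ y) →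
      SymmetricWrtPerpBisector (hullUnion K L φ ψ) (φ x) (ψ y)

/-- Condition (5) of Theorem 7. -/
def T7Cond5 (d : ℕ) (K L : Set X) : Prop :=
  ∃ δ > (0 : ℝ), ∀ φ ψ : X ≃ᵢ X, GoodPair d K L φ ψ →
    ∀ x ∈ frontier K, ∀ y ∈ frontier L,
      BigDiam d X (hullUnion K L φ ψ) δ →
      UniqueDiametral (hullUnion K L φ ψ) (φ x) (ψ y) →
      ∃ ε₀ > (0 : ℝ), ∀ ε : ℝ, 0 < ε → ε < ε₀ →
        (IsSphereSpace X d → ∃ s : X, (⇑φ '' K) ∪ (⇑ψ '' L) ⊆ ball s (Real.pi / 2) ∧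
            segCyl (φ x) (ψ y) ε ⊆ ball s (Real.pi / 2)) ∧
        CentrallySymmetric (hullUnion K L φ ψ ∩ segCyl (φ x) (ψ y) ε)

/-- Condition (6) of Theorem 7. -/
def T7Cond6 (d : ℕ) (K L : Set X) : Prop :=
  ∃ δ > (0 : ℝ), ∀ φ ψ : X ≃ᵢ X, GoodPair d K L φ ψ →
    ∀ x ∈ frontier K, ∀ y ∈ frontier L,
      BigDiam d X (hullUnion K L φ ψ) δ →
      UniqueDiametral (hullUnion K L φ ψ) (φ x) (ψ y) →
      ∃ ε₀ > (0 : ℝ), ∀ ε : ℝ, 0 < ε → ε < ε₀ →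
        (IsSphereSpace X d → ∃ s : X, (⇑φ '' K) ∪ (⇑ψ '' L) ⊆ ball s (Real.pi / 2) ∧
            segCyl (φ x) (ψ y) ε ⊆ ball s (Real.pi / 2)) ∧
        SymmetricWrtPerpBisector (hullUnion K L φ ψ ∩ segCyl (φ x) (ψ y) ε) (φ x) (ψ y)

/-- Condition (7) of Theorem 7: `K` and `L` are congruent balls. -/
def T7Cond7 (d : ℕ) (K L : Set X) : Prop :=
  ∃ r > (0 : ℝ), (IsSphereSpace X d → r < Real.pi / 2) ∧
    (∃ p : X, K = closedBall p r) ∧ ∃ q : X, L = closedBall q r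

/-- Condition (1) of Theorem 8. -/
def T8Cond1 (K L : Set X) : Prop :=
  ∀ φ ψ : X ≃ᵢ X, GoodPair 2 K L φ ψ → AxiallySymmetric (hullUnion K L φ ψ)

/-- Condition (2) of Theorem 8. -/
def T8Cond2 (K L : Set X) : Prop :=
  ∀ φ ψ : X ≃ᵢ X, GoodPair 2 K L φ ψ → AdmitsNontrivialCongruence (hullUnion K L φ ψ)

/-- Condition (3) of Theorem 8. -/
def T8Cond3 (K L : Set X) : Prop :=
  ∃ δ > (0 : ℝ), ∀ φ ψ : X ≃ᵢ X, GoodPair 2 K L φ ψ →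
    ∀ x ∈ frontier K, ∀ y ∈ frontier L,
      BigDiam 2 X (hullUnion K L φ ψ) δ →
      UniqueDiametral (hullUnion K L φ ψ) (φ x) (ψ y) →
      AxiallySymmetric (hullUnion K L φ ψ)

/-- Condition (4) of Theorem 8. -/
def T8Cond4 (K L : Set X) : Prop :=
  ∃ δ > (0 : ℝ), ∀ φ ψ : X ≃ᵢ X, GoodPair 2 K L φ ψ →
    ∀ x ∈ frontier K, ∀ y ∈ frontier L,
      BigDiam 2 X (hullUnion K L φ ψ) δ →
      UniqueDiametral (hullUnion K L φ ψ) (φ x) (ψ y) →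
      AdmitsNontrivialCongruence (hullUnion K L φ ψ)

/-- Condition (5) of Theorem 8. -/
def T8Cond5 (K L : Set X) : Prop :=
  ∃ δ > (0 : ℝ), ∀ φ ψ : X ≃ᵢ X, GoodPair 2 K L φ ψ →
    ∀ x ∈ frontier K, ∀ y ∈ frontier L,
      BigDiam 2 X (hullUnion K L φ ψ) δ →
      UniqueDiametral (hullUnion K L φ ψ) (φ x) (ψ y) →
      ∃ ε₀ > (0 : ℝ), ∀ ε : ℝ, 0 < ε → ε < ε₀ →
        (IsSphereSpace X 2 → ∃ s : X, (⇑φ '' K) ∪ (⇑ψ '' L) ⊆ ball s (Real.pi / 2) ∧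
            segCyl (φ x) (ψ y) ε ⊆ ball s (Real.pi / 2)) ∧
        AxiallySymmetric (hullUnion K L φ ψ ∩ segCyl (φ x) (ψ y) ε)

/-- Condition (6) of Theorem 8. -/
def T8Cond6 (K L : Set X) : Prop :=
  ∃ δ > (0 : ℝ), ∀ φ ψ : X ≃ᵢ X, GoodPair 2 K L φ ψ →
    ∀ x ∈ frontier K, ∀ y ∈ frontier L,
      BigDiam 2 X (hullUnion K L φ ψ) δ →
      UniqueDiametral (hullUnion K L φ ψ) (φ x) (ψ y) →
      ∃ ε₀ > (0 : ℝ), ∀ ε : ℝ, 0 < ε → ε < ε₀ →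
        (IsSphereSpace X 2 → ∃ s : X, (⇑φ '' K) ∪ (⇑ψ '' L) ⊆ ball s (Real.pi / 2) ∧
            segCyl (φ x) (ψ y) ε ⊆ ball s (Real.pi / 2)) ∧
        AdmitsNontrivialCongruence (hullUnion K L φ ψ ∩ segCyl (φ x) (ψ y) ε)

/-- Condition (7) of Theorem 8: `K` and `L` are (in general incongruent) circles. -/
def T8Cond7 (K L : Set X) : Prop :=
  ∃ (p q : X) (r s : ℝ), 0 < r ∧ 0 < s ∧
    (IsSphereSpace X 2 → r < Real.pi / 2 ∧ s < Real.pi / 2) ∧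
    K = closedBall p r ∧ L = closedBall q s


/-- The Minkowski space `ℝ² × ℝ` containing the hyperboloid. -/
abbrev MinkSpace := EuclideanSpace ℝ (Fin 2) × ℝ

theorem mink_eq (u v : MinkSpace) :
    mink 2 u v = u.1 0 * v.1 0 + u.1 1 * v.1 1 - u.2 * v.2 := by
  simp [mink, PiLp.inner_apply, Fin.sum_univ_two]
  ring

theorem MinkSpace.ext' {u v : MinkSpace} (h0 : u.1 0 = v.1 0) (h1 : u.1 1 = v.1 1)
    (h2 : u.2 = v.2) : u = v := by
  refine Prod.ext (PiLp.ext fun i => ?_) h2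
  fin_cases i <;> assumption

theorem mink_comm (u v : MinkSpace) : mink 2 u v = mink 2 v u := by
  simp only [mink_eq]; ring

@[simp] theorem mink_add_left (u v w : MinkSpace) : mink 2 (u + v) w = mink 2 u w + mink 2 v w := by
  simp [mink_eq]; ring

@[simp] theorem mink_add_right (u v w : MinkSpace) : mink 2 w (u + v) = mink 2 w u + mink 2 w v := by
  simp [mink_eq]; ring

@[simp] theorem mink_sub_left (u v w : MinkSpace) : mink 2 (u - v) w = mink 2 u w - mink 2 v w := by
  simp [mink_eq]; ring

@[simp] theorem mink_sub_right (u v w : MinkSpace) : mink 2 w (u - v) = mink 2 w u - mink 2 w v := by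
  simp [mink_eq]; ring

@[simp] theorem mink_smul_left (c : ℝ) (u w : MinkSpace) : mink 2 (c • u) w = c * mink 2 u w := by
  simp [mink_eq]; ring

@[simp] theorem mink_smul_right (c : ℝ) (u w : MinkSpace) : mink 2 w (c • u) = c * mink 2 w u := by
  simp [mink_eq]; ring

@[simp] theorem mink_neg_left (u w : MinkSpace) : mink 2 (-u) w = -mink 2 u w := by
  simp [mink_eq]; ring

@[simp] theorem mink_neg_right (u w : MinkSpace) : mink 2 w (-u) = -mink 2 w u := by
  simp [mink_eq]; ring

theorem continuous_mink : Continuous fun p : MinkSpace × MinkSpace => mink 2 p.1 p.2 := by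
  simp only [mink_eq]; fun_prop

theorem Continuous.mink {Y : Type*} [TopologicalSpace Y] {f g : Y → MinkSpace}
    (hf : Continuous f) (hg : Continuous g) : Continuous fun y => mink 2 (f y) (g y) :=
  continuous_mink.comp (hf.prodMk hg)

/-- The Lorentzian cross product. -/
noncomputable def cross (u v : MinkSpace) : MinkSpace :=
  (!₂[u.1 1 * v.2 - u.2 * v.1 1, u.2 * v.1 0 - u.1 0 * v.2],
    -(u.1 0 * v.1 1 - u.1 1 * v.1 0))

theorem mink_cross_left (u v : MinkSpace) : mink 2 (cross u v) u = 0 := by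
  simp [mink_eq, cross]; ring

theorem mink_cross_right (u v : MinkSpace) : mink 2 (cross u v) v = 0 := by
  simp [mink_eq, cross]; ring

theorem mink_cross_cross (u v : MinkSpace) :
    mink 2 (cross u v) (cross u v) = mink 2 u v ^ 2 - mink 2 u u * mink 2 v v := by
  simp [mink_eq, cross]; ring

theorem cramer (u v w h : MinkSpace) : mink 2 (cross u v) w • h =
    mink 2 h u • cross v w + mink 2 h v • cross w u + mink 2 h w • cross u v := by
  apply MinkSpace.ext' <;> simp [mink_eq, cross] <;> ring

theorem eq_zero_of_mink_eq_zero {u v w h : MinkSpace} (hd : mink 2 (cross u v) w ≠ 0)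
    (hu : mink 2 h u = 0) (hv : mink 2 h v = 0) (hw : mink 2 h w = 0) : h = 0 := by
  have := cramer u v w h
  simp only [hu, hv, hw, zero_smul, add_zero] at this
  exact (smul_eq_zero.1 this).resolve_left hd

theorem parallel_of_cross_eq_zero {u v : MinkSpace} (h : cross u v = 0) (hu : u ≠ 0) :
    ∃ c : ℝ, v = c • u := by
  have h0 : u.1 1 * v.2 - u.2 * v.1 1 = 0 := by simpa [cross] using congrArg (fun w => w.1 0) h
  have h1 : u.2 * v.1 0 - u.1 0 * v.2 = 0 := by simpa [cross] using congrArg (fun w => w.1 1) h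
  have h2 : u.1 0 * v.1 1 - u.1 1 * v.1 0 = 0 := by
    have : -(u.1 0 * v.1 1 - u.1 1 * v.1 0) = 0 := by
      exact congrArg (fun w : MinkSpace => w.2) h
    linarith
  have hpos : 0 < u.1 0 ^ 2 + u.1 1 ^ 2 + u.2 ^ 2 := by
    by_contra hn
    apply hu
    apply MinkSpace.ext' <;> simp <;> nlinarith [sq_nonneg (u.1 0), sq_nonneg (u.1 1), sq_nonneg u.2]
  refine ⟨(u.1 0 * v.1 0 + u.1 1 * v.1 1 + u.2 * v.2) / (u.1 0 ^ 2 + u.1 1 ^ 2 + u.2 ^ 2), ?_⟩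
  apply MinkSpace.ext' <;> simp <;> field_simp
  · linear_combination -u.1 1 * h2 + u.2 * h1
  · linear_combination u.1 0 * h2 - u.2 * h0
  · linear_combination u.1 1 * h0 - u.1 0 * h1

theorem parallel_cross {u v h : MinkSpace} (hc : cross u v ≠ 0) (hu : mink 2 h u = 0)
    (hv : mink 2 h v = 0) : ∃ c : ℝ, h = c • cross u v := by
  refine parallel_of_cross_eq_zero ?_ hc
  have key : cross (cross u v) h = mink 2 h v • u - mink 2 h u • v := by
    apply MinkSpace.ext' <;> simp [mink_eq, cross] <;> ring
  rw [key, hu, hv]; simp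

/-- A vector orthogonal to a timelike one is spacelike. -/
theorem mink_self_pos_of_orth {a h : MinkSpace} (ha : mink 2 a a < 0) (h0 : mink 2 h a = 0)
    (hh : h ≠ 0) : 0 < mink 2 h h := by
  by_contra hn
  apply hh
  rw [mink_eq] at *
  set p := h.1 0
  set q := h.1 1
  have e1 : (h.2 * a.2) ^ 2 = (p * a.1 0 + q * a.1 1) ^ 2 := by congr 1; linarith
  have e2 : (p * a.1 0 + q * a.1 1) ^ 2 ≤ (p ^ 2 + q ^ 2) * (a.1 0 ^ 2 + a.1 1 ^ 2) := by
    nlinarith [sq_nonneg (p * a.1 1 - q * a.1 0)]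
  have e3 : p ^ 2 + q ^ 2 = 0 := by
    by_contra hne
    have : 0 < p ^ 2 + q ^ 2 := by positivity
    have : (p ^ 2 + q ^ 2) * (a.1 0 ^ 2 + a.1 1 ^ 2) < (p ^ 2 + q ^ 2) * a.2 ^ 2 :=
      mul_lt_mul_of_pos_left (by nlinarith) this
    nlinarith [sq_nonneg a.2]
  have ep : p = 0 := by nlinarith [sq_nonneg p, sq_nonneg q]
  have eq : q = 0 := by nlinarith [sq_nonneg p, sq_nonneg q]
  have e4 : h.2 = 0 := by
    have : a.2 ≠ 0 := by
      rintro h; rw [h] at ha; nlinarith [sq_nonneg (a.1 0), sq_nonneg (a.1 1)]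
    have h5 : h.2 * a.2 = 0 := by rw [ep, eq] at h0; linarith
    exact (mul_eq_zero.1 h5).resolve_right this
  exact MinkSpace.ext' ep eq e4

/-- The open cone of future timelike vectors. -/
def futureCone : Set MinkSpace := {v | mink 2 v v < 0 ∧ 0 < v.2}

theorem isOpen_futureCone : IsOpen futureCone :=
  (isOpen_lt (Continuous.mink continuous_id continuous_id) continuous_const).inter
    (isOpen_lt continuous_const continuous_snd)

theorem mink_sq_ge {u v : MinkSpace} (hu : mink 2 u u < 0) :
    mink 2 u u * mink 2 v v ≤ mink 2 u v ^ 2 := by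
  have h := mink_cross_cross u v
  rcases eq_or_ne (cross u v) 0 with h0 | h0
  · rw [h0] at h; simp [mink_eq] at h ⊢; linarith
  · have := mink_self_pos_of_orth hu (mink_cross_left u v) h0
    linarith

theorem mink_neg_of_futureCone {u v : MinkSpace} (hu : u ∈ futureCone) (hv : v ∈ futureCone) :
    mink 2 u v < 0 := by
  obtain ⟨h1, h2⟩ := hu
  obtain ⟨h3, h4⟩ := hv
  rw [mink_eq] at *
  have e : (u.1 0 * v.1 0 + u.1 1 * v.1 1) ^ 2 < (u.2 * v.2) ^ 2 := by
    have : (u.1 0 * v.1 0 + u.1 1 * v.1 1) ^ 2 ≤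
        (u.1 0 ^ 2 + u.1 1 ^ 2) * (v.1 0 ^ 2 + v.1 1 ^ 2) := by
      nlinarith [sq_nonneg (u.1 0 * v.1 1 - u.1 1 * v.1 0)]
    have : (u.1 0 ^ 2 + u.1 1 ^ 2) * (v.1 0 ^ 2 + v.1 1 ^ 2) < u.2 ^ 2 * v.2 ^ 2 :=
      mul_lt_mul'' (by nlinarith) (by nlinarith) (by positivity) (by positivity)
    linarith [mul_pow u.2 v.2 2]
  have := abs_lt_of_sq_lt_sq e (by positivity)
  linarith [(abs_lt.1 this).2]

theorem mem_futureCone_of_mink_neg {u v : MinkSpace} (hu : mink 2 u u < 0) (hv : v ∈ futureCone)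
    (h : mink 2 u v < 0) : u ∈ futureCone := by
  refine ⟨hu, ?_⟩
  by_contra hn
  rcases (not_lt.1 hn).lt_or_eq with h2 | h2
  · have := mink_neg_of_futureCone (u := -u) (v := v)
      ⟨by rwa [mink_neg_left, mink_neg_right, neg_neg], by simpa using h2⟩ hv
    rw [mink_neg_left] at this
    linarith
  · rw [mink_eq, h2] at hu
    nlinarith [sq_nonneg (u.1 0), sq_nonneg (u.1 1)]

theorem add_mem_futureCone {u v : MinkSpace} (hu : u ∈ futureCone) (hv : v ∈ futureCone) :
    u + v ∈ futureCone := by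
  have := mink_neg_of_futureCone hu hv
  refine ⟨?_, add_pos hu.2 hv.2⟩
  simp only [mink_add_left, mink_add_right, mink_comm v u]
  linarith [hu.1, hv.1]

theorem smul_mem_futureCone {u : MinkSpace} (hu : u ∈ futureCone) {c : ℝ} (hc : 0 < c) :
    c • u ∈ futureCone := by
  refine ⟨?_, mul_pos hc hu.2⟩
  rw [mink_smul_left, mink_smul_right, ← mul_assoc]
  exact mul_neg_of_pos_of_neg (by positivity) hu.1

/-- `e` identifies `X` with the hyperboloid in `MinkSpace`. -/
structure IsModel (e : X → MinkSpace) : Prop where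
  inj : Function.Injective e
  range_eq : range e = {u | mink 2 u u = -1 ∧ 0 < u.2}
  cosh_dist : ∀ x y : X, Real.cosh (dist x y) = -mink 2 (e x) (e y)

namespace IsModel

variable {e : X → MinkSpace} (he : IsModel e)
include he

theorem mink_self (x : X) : mink 2 (e x) (e x) = -1 := by
  have := he.cosh_dist x x
  rw [dist_self, Real.cosh_zero] at this
  linarith

theorem mem_futureCone (x : X) : e x ∈ futureCone := by
  have : e x ∈ range e := mem_range_self x
  rw [he.range_eq] at this
  exact ⟨by rw [this.1]; norm_num, this.2⟩

theorem mink_le (x y : X) : mink 2 (e x) (e y) ≤ -1 := by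
  have := he.cosh_dist x y
  have := Real.one_le_cosh (dist x y)
  linarith

theorem exists_eq {v : MinkSpace} (h1 : mink 2 v v = -1) (h2 : v ∈ futureCone) :
    ∃ x, e x = v := by
  have : v ∈ range e := by rw [he.range_eq]; exact ⟨h1, h2.2⟩
  exact this

theorem exists_proj (v : MinkSpace) :
    ∃ x, v ∈ futureCone → e x = (√(-mink 2 v v))⁻¹ • v := by
  by_cases hv : v ∈ futureCone
  · have hp : 0 < -mink 2 v v := by linarith [hv.1]
    have hs := Real.sqrt_pos.2 hp
    obtain ⟨x, hx⟩ := he.exists_eq (v := (√(-mink 2 v v))⁻¹ • v) (by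
      simp only [mink_smul_left, mink_smul_right]
      field_simp
      rw [Real.sq_sqrt hp.le]; ring) (smul_mem_futureCone hv (by positivity))
    exact ⟨x, fun _ => hx⟩
  · obtain ⟨x, -⟩ := he.exists_eq (v := ((0 : EuclideanSpace ℝ (Fin 2)), (1 : ℝ)))
      (by simp [mink_eq]) (by simp [futureCone, mink_eq])
    exact ⟨x, fun h => absurd h hv⟩

/-- The radial projection of the future cone onto the hyperboloid. -/
noncomputable def proj (v : MinkSpace) : X := (he.exists_proj v).choose

theorem e_proj {v : MinkSpace} (hv : v ∈ futureCone) :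
    e (he.proj v) = (√(-mink 2 v v))⁻¹ • v := (he.exists_proj v).choose_spec hv

theorem e_proj_of_mink_self {v : MinkSpace} (hv : v ∈ futureCone) (h : mink 2 v v = -1) :
    e (he.proj v) = v := by
  rw [he.e_proj hv, h]; simp

theorem proj_e (x : X) : he.proj (e x) = x :=
  he.inj (he.e_proj_of_mink_self (he.mem_futureCone x) (he.mink_self x))

theorem dist_le_iff {x y : X} {r : ℝ} (hr : 0 ≤ r) :
    dist x y ≤ r ↔ -mink 2 (e x) (e y) ≤ Real.cosh r := by
  rw [← he.cosh_dist, Real.cosh_le_cosh, abs_of_nonneg dist_nonneg, abs_of_nonneg hr]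

theorem dist_lt_iff {x y : X} {r : ℝ} (hr : 0 ≤ r) :
    dist x y < r ↔ -mink 2 (e x) (e y) < Real.cosh r := by
  rw [← he.cosh_dist, Real.cosh_lt_cosh, abs_of_nonneg dist_nonneg, abs_of_nonneg hr]

theorem dist_eq_iff {x y : X} {r : ℝ} (hr : 0 ≤ r) :
    dist x y = r ↔ -mink 2 (e x) (e y) = Real.cosh r := by
  rw [le_antisymm_iff, le_antisymm_iff, ← not_lt (a := dist x y), he.dist_le_iff hr,
    he.dist_lt_iff hr, not_lt]

theorem continuous_e : Continuous e := by
  have hc : ∀ v : MinkSpace, mink 2 v v = -1 → v ∈ futureCone →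
      Continuous fun y => mink 2 (e y) v := by
    intro v h1 h2
    obtain ⟨z, rfl⟩ := he.exists_eq h1 h2
    have : (fun y => mink 2 (e y) (e z)) = fun y => -Real.cosh (dist y z) := by
      ext y; rw [he.cosh_dist, neg_neg]
    rw [this]
    exact (Real.continuous_cosh.comp (continuous_id.dist continuous_const)).neg
  have hs : √2 * √2 = 2 := Real.mul_self_sqrt (by norm_num)
  have h2 : Continuous fun y => (e y).2 := by
    have := (hc ((0 : EuclideanSpace ℝ (Fin 2)), (1 : ℝ)) (by simp [mink_eq])
      (by simp [futureCone, mink_eq]))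
    refine this.neg.congr fun y => ?_
    simp [mink_eq]
  have h0 : Continuous fun y => (e y).1 0 := by
    have := (hc (!₂[1, 0], √2) (by simp [mink_eq]; norm_num)
      (by simp [futureCone, mink_eq])).add (h2.const_mul √2)
    refine this.congr fun y => ?_
    simp [mink_eq]; ring
  have h1 : Continuous fun y => (e y).1 1 := by
    have := (hc (!₂[0, 1], √2) (by simp [mink_eq]; norm_num)
      (by simp [futureCone, mink_eq])).add (h2.const_mul √2)
    refine this.congr fun y => ?_
    simp [mink_eq]; ring
  refine Continuous.prodMk (f := fun y => (e y).1) ?_ h2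
  refine (PiLp.continuous_toLp 2 _).comp (g := WithLp.toLp 2) (f := fun y => (e y).1.ofLp) ?_
  refine continuous_pi fun i => ?_
  fin_cases i
  · exact h0
  · exact h1

theorem isInducing : Topology.IsInducing e := by
  refine Topology.isInducing_iff_nhds.2 fun x => le_antisymm he.continuous_e.continuousAt.le_comap ?_
  intro s hs
  obtain ⟨ε, hε, hsub⟩ := Metric.mem_nhds_iff.1 hs
  refine ⟨{v | -mink 2 v (e x) < Real.cosh ε}, ?_, fun y hy => hsub ?_⟩
  · refine (isOpen_lt (Continuous.mink continuous_id continuous_const).neg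
      continuous_const).mem_nhds ?_
    change -mink 2 (e x) (e x) < Real.cosh ε
    rw [he.mink_self, neg_neg]
    exact Real.one_lt_cosh.2 hε.ne'
  · exact (he.dist_lt_iff hε.le).2 hy

theorem secondCountableTopology : SecondCountableTopology X :=
  he.isInducing.secondCountableTopology

theorem continuous_mink_e (w : MinkSpace) : Continuous fun x => mink 2 (e x) w :=
  Continuous.mink he.continuous_e continuous_const

theorem continuousOn_proj : ContinuousOn he.proj futureCone := by
  rw [he.isInducing.continuousOn_iff]
  have hq : Continuous fun v : MinkSpace => √(-mink 2 v v) :=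
    Real.continuous_sqrt.comp (Continuous.mink (f := id) (g := id) continuous_id continuous_id).neg
  have : ContinuousOn (fun v : MinkSpace => (√(-mink 2 v v))⁻¹ • v) futureCone :=
    (hq.continuousOn.inv₀ fun v hv => (Real.sqrt_pos.2 (by linarith [hv.1])).ne').smul
      continuousOn_id
  exact this.congr fun v hv => he.e_proj hv

theorem continuousAt_proj {v : MinkSpace} (hv : v ∈ futureCone) : ContinuousAt he.proj v :=
  he.continuousOn_proj.continuousAt (isOpen_futureCone.mem_nhds hv)

/-- The sign of a linear form is unchanged by the radial projection. -/
theorem mink_proj {v : MinkSpace} (hv : v ∈ futureCone) (w : MinkSpace) :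
    mink 2 (e (he.proj v)) w = (√(-mink 2 v v))⁻¹ * mink 2 v w := by
  rw [he.e_proj hv, mink_smul_left]

theorem exists_proj_eq {v : MinkSpace} (hv : v ∈ futureCone) :
    ∃ c : ℝ, 0 < c ∧ e (he.proj v) = c • v :=
  ⟨_, inv_pos.2 (Real.sqrt_pos.2 (by linarith [hv.1])), he.e_proj hv⟩

end IsModel

theorem mink_cross_sq (u v w : MinkSpace) :
    mink 2 (cross u v) w ^ 2 = -(mink 2 u u * (mink 2 v v * mink 2 w w - mink 2 v w ^ 2)
      - mink 2 u v * (mink 2 u v * mink 2 w w - mink 2 v w * mink 2 u w)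
      + mink 2 u w * (mink 2 u v * mink 2 v w - mink 2 v v * mink 2 u w)) := by
  simp only [mink_eq, cross]
  simp
  ring

namespace IsModel

variable {e : X → MinkSpace} (he : IsModel e)
include he

theorem mink_isometry (σ : X ≃ᵢ X) (x y : X) :
    mink 2 (e (σ x)) (e (σ y)) = mink 2 (e x) (e y) := by
  have h1 := he.cosh_dist x y
  have h2 := he.cosh_dist (σ x) (σ y)
  rw [σ.dist_eq] at h2
  linarith

theorem exists_linear (σ : X ≃ᵢ X) : ∃ T : MinkSpace →ₗ[ℝ] MinkSpace,
    (∀ u v, mink 2 (T u) (T v) = mink 2 u v) ∧ ∀ x, T (e x) = e (σ x) := by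
  have hs : √2 * √2 = 2 := Real.mul_self_sqrt (by norm_num)
  obtain ⟨p2, h2⟩ := he.exists_eq (v := ((0 : EuclideanSpace ℝ (Fin 2)), (1 : ℝ)))
    (by simp [mink_eq]) (by simp [futureCone, mink_eq])
  obtain ⟨p0, h0⟩ := he.exists_eq (v := (!₂[1, 0], √2)) (by simp [mink_eq]; norm_num)
    (by simp [futureCone, mink_eq])
  obtain ⟨p1, h1⟩ := he.exists_eq (v := (!₂[0, 1], √2)) (by simp [mink_eq]; norm_num)
    (by simp [futureCone, mink_eq])
  have hm := he.mink_isometry σ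
  set f2 := e (σ p2) with hf2
  set f0 := e (σ p0) - √2 • f2 with hf0
  set f1 := e (σ p1) - √2 • f2 with hf1
  have hx0 : ∀ x, mink 2 (e (σ x)) f0 = (e x).1 0 := by
    intro x; rw [hf0, mink_sub_right, mink_smul_right, hm, hf2, hm, h0, h2, mink_eq, mink_eq]
    simp
    ring
  have hx1 : ∀ x, mink 2 (e (σ x)) f1 = (e x).1 1 := by
    intro x; rw [hf1, mink_sub_right, mink_smul_right, hm, hf2, hm, h1, h2, mink_eq, mink_eq]
    simp
    ring
  have hx2 : ∀ x, mink 2 (e (σ x)) f2 = -(e x).2 := by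
    intro x; simp only [hf2, hm, h2, mink_eq]; simp
  have m20 : mink 2 f2 f0 = 0 := by rw [hf2, hx0, h2]; simp
  have m21 : mink 2 f2 f1 = 0 := by rw [hf2, hx1, h2]; simp
  have m22 : mink 2 f2 f2 = -1 := (hx2 p2).trans (by rw [h2])
  have m00 : mink 2 f0 f0 = 1 := by
    nth_rw 1 [hf0]; rw [mink_sub_left, mink_smul_left, hx0, m20, h0]; simp
  have m11 : mink 2 f1 f1 = 1 := by
    nth_rw 1 [hf1]; rw [mink_sub_left, mink_smul_left, hx1, m21, h1]; simp
  have m01 : mink 2 f0 f1 = 0 := by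
    nth_rw 1 [hf0]; rw [mink_sub_left, mink_smul_left, hx1, m21, h0]; simp
  refine ⟨{ toFun := fun v => v.1 0 • f0 + v.1 1 • f1 + v.2 • f2
            map_add' := ?_, map_smul' := ?_ }, ?_, ?_⟩
  · intro u v
    simp only [Prod.fst_add, Prod.snd_add, PiLp.add_apply]
    module
  · intro c v
    simp only [Prod.smul_fst, Prod.smul_snd, PiLp.smul_apply, RingHom.id_apply, smul_eq_mul]
    module
  · intro u v
    simp only [LinearMap.coe_mk, AddHom.coe_mk, mink_add_left, mink_add_right, mink_smul_left,
      mink_smul_right, m00, m11, m22, m01, m20, m21, mink_comm f1 f0, mink_comm f0 f2,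
      mink_comm f1 f2]
    rw [mink_eq u v]
    ring
  · intro x
    simp only [LinearMap.coe_mk, AddHom.coe_mk]
    have hd : mink 2 (cross f0 f1) f2 ≠ 0 := by
      have := mink_cross_sq f0 f1 f2
      rw [m00, m11, m22, m01, mink_comm f1 f2, mink_comm f0 f2, m20, m21] at this
      intro h
      rw [h] at this
      norm_num at this
    rw [← sub_eq_zero]
    refine eq_zero_of_mink_eq_zero hd ?_ ?_ ?_
    · simp only [mink_sub_left, mink_add_left, mink_smul_left, hx0, m00, m20, mink_comm f1 f0, m01]
      ring
    · simp only [mink_sub_left, mink_add_left, mink_smul_left, hx1, m11, m21, m01]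
      ring
    · simp only [mink_sub_left, mink_add_left, mink_smul_left, hx2, m22, mink_comm f0 f2,
        mink_comm f1 f2, m20, m21]
      ring

/-- The reflection in the line orthogonal to a unit spacelike vector. -/
theorem exists_reflectionMap {d : MinkSpace} (hd : mink 2 d d = 1) :
    ∃ σ : X ≃ᵢ X, ∀ x, e (σ x) = e x - (2 * mink 2 (e x) d) • d := by
  have key : ∀ x, ∃ y, e y = e x - (2 * mink 2 (e x) d) • d := by
    intro x
    have h1 : mink 2 (e x - (2 * mink 2 (e x) d) • d) (e x - (2 * mink 2 (e x) d) • d) = -1 := by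
      simp only [mink_sub_left, mink_sub_right, mink_smul_left, mink_smul_right, hd,
        mink_comm d (e x), he.mink_self]
      ring
    refine he.exists_eq h1 (mem_futureCone_of_mink_neg (by rw [h1]; norm_num)
      (he.mem_futureCone x) ?_)
    simp only [mink_sub_left, mink_smul_left, mink_comm d (e x), he.mink_self]
    nlinarith [sq_nonneg (mink 2 (e x) d)]
  choose f hf using key
  have hinv : ∀ x, f (f x) = x := by
    intro x
    apply he.inj
    rw [hf, hf]
    simp only [mink_sub_left, mink_smul_left, hd]
    module
  refine ⟨⟨⟨f, f, hinv, hinv⟩, ?_⟩, hf⟩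
  refine Isometry.of_dist_eq fun x y => ?_
  change dist (f x) (f y) = _
  rw [he.dist_eq_iff dist_nonneg, he.cosh_dist, hf, hf]
  simp only [mink_sub_left, mink_sub_right, mink_smul_left, mink_smul_right, hd,
        mink_comm d (e _)]
  ring

/-- Convex cones of future vectors project to preconnected sets. -/
theorem isPreconnected_halfplane (d : MinkSpace) :
    IsPreconnected {x : X | 0 < mink 2 (e x) d} := by
  have hc : Convex ℝ {v : MinkSpace | v ∈ futureCone ∧ 0 < mink 2 v d} := by
    rw [convex_iff_forall_pos]
    rintro u ⟨hu, hu'⟩ v ⟨hv, hv'⟩ a b ha hb -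
    refine ⟨add_mem_futureCone (smul_mem_futureCone hu ha) (smul_mem_futureCone hv hb), ?_⟩
    simp only [mink_add_left, mink_smul_left]
    positivity
  have := hc.isPreconnected.image he.proj (he.continuousOn_proj.mono fun v hv => hv.1)
  convert this using 1
  ext x
  constructor
  · intro hx
    exact ⟨e x, ⟨he.mem_futureCone x, hx⟩, he.proj_e x⟩
  · rintro ⟨v, ⟨hv, hv'⟩, rfl⟩
    obtain ⟨c, hc, h⟩ := he.exists_proj_eq hv
    simp only [mem_ofPred_eq, h, mink_smul_left]
    positivity

end IsModel

theorem mink_self_cross {d a : MinkSpace} (hd : mink 2 d d = 1) (ha : mink 2 a a = -1)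
    (hda : mink 2 d a = 0) : mink 2 (cross d a) (cross d a) = 1 := by
  rw [mink_cross_cross, hd, ha, hda]; norm_num

theorem orthonormal_expansion {d a : MinkSpace} (hd : mink 2 d d = 1) (ha : mink 2 a a = -1)
    (hda : mink 2 d a = 0) (v : MinkSpace) :
    v = mink 2 v d • d - mink 2 v a • a + mink 2 v (cross d a) • cross d a := by
  have hk := mink_self_cross hd ha hda
  rw [← sub_eq_zero]
  refine eq_zero_of_mink_eq_zero (u := d) (v := a) (w := cross d a) (by rw [hk]; norm_num) ?_ ?_ ?_
  · simp only [mink_sub_left, mink_add_left, mink_smul_left, hd, mink_comm a d, hda,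
      mink_cross_left]
    ring
  · simp only [mink_sub_left, mink_add_left, mink_smul_left, ha, hda,
      mink_cross_right]
    ring
  · simp only [mink_sub_left, mink_add_left, mink_smul_left, hk, mink_comm d (cross d a),
      mink_comm a (cross d a), mink_cross_right, mink_cross_left]
    ring

namespace IsModel

variable {e : X → MinkSpace} (he : IsModel e)
include he

theorem exists_halfplane_inter {a d k : MinkSpace} (ha : mink 2 a a = -1) (ha' : a ∈ futureCone)
    (hd : mink 2 d d = 1) (hk : mink 2 k k = 1) (hda : mink 2 d a = 0) (hka : mink 2 k a = 0)
    (hdk : mink 2 d k = 0) :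
    ∃ x : X, 0 < mink 2 (e x) d ∧ 0 < mink 2 (e x) k := by
  have hv : (2 : ℝ) • a + d + k ∈ futureCone := by
    refine mem_futureCone_of_mink_neg ?_ ha' ?_
    · simp only [mink_add_left, mink_add_right, mink_smul_left, mink_smul_right, ha, hd, hk, hda,
        hka, hdk, mink_comm a d, mink_comm a k, mink_comm k d]
      norm_num
    · simp only [mink_add_left, mink_smul_left, ha, hda, hka]
      norm_num
  obtain ⟨c, hc, h⟩ := he.exists_proj_eq hv
  refine ⟨he.proj ((2 : ℝ) • a + d + k), ?_, ?_⟩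
  · simp only [h, mink_smul_left, mink_add_left, mink_comm a d, hda, hd, mink_comm k d, hdk]
    simpa using hc
  · simp only [h, mink_smul_left, mink_add_left, mink_comm a k, hka, hk, hdk]
    simpa using hc

/-- The complement of a point in the plane is preconnected. -/
theorem isPreconnected_punctured {a d k : MinkSpace} (ha : mink 2 a a = -1)
    (ha' : a ∈ futureCone) (hd : mink 2 d d = 1) (hk : mink 2 k k = 1) (hda : mink 2 d a = 0)
    (hka : mink 2 k a = 0) (hdk : mink 2 d k = 0) :
    IsPreconnected {x : X | mink 2 (e x) d ≠ 0 ∨ mink 2 (e x) k ≠ 0} := by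
  have hd' : mink 2 (-d) (-d) = 1 := by simpa using hd
  have hk' : mink 2 (-k) (-k) = 1 := by simpa using hk
  obtain ⟨x1, h11, h12⟩ := he.exists_halfplane_inter ha ha' hd hk hda hka hdk
  obtain ⟨x2, h21, h22⟩ := he.exists_halfplane_inter ha ha' hd' hk (by simpa using hda) hka
    (by simpa using hdk)
  obtain ⟨x3, h31, h32⟩ := he.exists_halfplane_inter ha ha' hd hk' hda (by simpa using hka)
    (by simpa using hdk)
  have := (((he.isPreconnected_halfplane d).union x1 h11 h12
    (he.isPreconnected_halfplane k)).union x2 (Or.inr h22) h21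
    (he.isPreconnected_halfplane (-d))).union x3 (Or.inl (Or.inl h31)) h32
    (he.isPreconnected_halfplane (-k))
  convert this using 1
  ext x
  simp only [mem_ofPred_eq, mem_union, mink_neg_right, Left.neg_pos_iff]
  rw [ne_iff_lt_or_gt, ne_iff_lt_or_gt]
  tauto

theorem exists_vector_of_isReflection {σ : X ≃ᵢ X} (hσ : IsReflection σ) :
    ∃ d : MinkSpace, mink 2 d d = 1 ∧ ∀ x, e (σ x) = e x - (2 * mink 2 (e x) d) • d := by
  obtain ⟨h1, h2, h3⟩ := hσ
  have hinv : ∀ x, σ (σ x) = x := fun x => by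
    exact congrArg (fun f : X ≃ᵢ X => f x) h1
  obtain ⟨x0, hx0⟩ : ∃ x, σ x ≠ x := by
    by_contra! h
    exact h2 (IsometryEquiv.ext h)
  obtain ⟨T, hT, hTe⟩ := he.exists_linear σ
  have hm := add_mem_futureCone (he.mem_futureCone x0) (he.mem_futureCone (σ x0))
  have hq := hm.1
  set m := e x0 + e (σ x0) with hmdef
  set d0 := e x0 - e (σ x0) with hd0
  have hTm : T m = m := by rw [hmdef, map_add, hTe, hTe, hinv, add_comm]
  have hTd0 : T d0 = -d0 := by rw [hd0, map_sub, hTe, hTe, hinv, neg_sub]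
  have hd0m : mink 2 d0 m = 0 := by
    simp only [hmdef, hd0, mink_sub_left, mink_add_right, he.mink_self, mink_comm (e (σ x0)) (e x0)]
    ring
  have hd0q : 0 < mink 2 d0 d0 := by
    refine mink_self_pos_of_orth hq hd0m fun h => hx0 ?_
    exact (he.inj (sub_eq_zero.1 h)).symm
  set d := (√(mink 2 d0 d0))⁻¹ • d0 with hd
  have hdd : mink 2 d d = 1 := by
    simp only [hd, mink_smul_left, mink_smul_right]
    have := Real.sqrt_pos.2 hd0q
    field_simp
    rw [Real.sq_sqrt hd0q.le]
  have hTd : T d = -d := by rw [hd, map_smul, hTd0, smul_neg]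
  obtain ⟨c, hc, ha⟩ := he.exists_proj_eq hm
  set a := e (he.proj m) with hadef
  have haa : mink 2 a a = -1 := he.mink_self _
  have hda : mink 2 d a = 0 := by rw [ha, hd]; simp [hd0m]
  have hTa : T a = a := by rw [ha, map_smul, hTm]
  clear_value d
  have hkk := mink_self_cross hdd haa hda
  have hexp := orthonormal_expansion hdd haa hda
  set k := cross d a with hk
  have hkd : mink 2 k d = 0 := mink_cross_left _ _
  have hka : mink 2 k a = 0 := mink_cross_right _ _
  clear_value k
  have hk0 : k ≠ 0 := by
    intro h; rw [h] at hkk; simp [mink_eq] at hkk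
  obtain ⟨s, hs⟩ : ∃ s : ℝ, T k = s • k := by
    rw [hk] at hk0 ⊢
    refine parallel_cross hk0 ?_ ?_ <;> rw [← hk]
    · have := hT k d
      rw [hTd, mink_neg_right, hkd] at this
      linarith
    · rw [← hTa, hT, hka]
  have hs1 : s * s = 1 := by
    have := hT k k
    rw [hs, mink_smul_left, mink_smul_right, hkk] at this
    linarith
  have hTx : ∀ x, e (σ x) = -(mink 2 (e x) d • d) - mink 2 (e x) a • a
      + (mink 2 (e x) k * s) • k := by
    intro x
    rw [← hTe]
    conv_lhs => rw [hexp (e x)]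
    rw [map_add, map_sub, map_smul, map_smul, map_smul, hTd, hTa, hs]
    module
  rcases mul_self_eq_one_iff.1 hs1 with rfl | rfl
  · refine ⟨d, hdd, fun x => ?_⟩
    rw [hTx]
    conv_rhs => rw [hexp (e x)]
    simp only [mink_sub_left, mink_add_left, mink_smul_left, hdd, mink_comm a d, hda, hkd]
    module
  · refine absurd ?_ h3
    convert he.isPreconnected_punctured haa (he.mem_futureCone _) hdd hkk hda hka
      (by rw [mink_comm]; exact hkd) using 1
    ext x
    simp only [mem_ofPred_eq, ne_eq, ← not_and_or, not_iff_not]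
    rw [← he.inj.eq_iff, hTx]
    constructor
    · intro h
      have e1 := congrArg (fun v => mink 2 v d) h
      have e2 := congrArg (fun v => mink 2 v k) h
      simp only [mink_sub_left, mink_add_left, mink_smul_left, mink_neg_left, hdd, mink_comm a d,
        hda, hkd, mink_comm d k, mink_comm a k, hka, hkk] at e1 e2
      constructor <;> linarith
    · rintro ⟨h, h'⟩
      conv_rhs => rw [hexp (e x)]
      rw [h, h']
      simp

theorem isReflection_of_vector {d : MinkSpace} (hd : mink 2 d d = 1) {σ : X ≃ᵢ X}
    (hσ : ∀ x, e (σ x) = e x - (2 * mink 2 (e x) d) • d) : IsReflection σ := by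
  have hd0 : d ≠ 0 := by rintro rfl; simp [mink_eq] at hd
  have hfix : ∀ x, σ x ≠ x ↔ mink 2 (e x) d ≠ 0 := by
    intro x
    rw [not_iff_not, ← he.inj.eq_iff, hσ, sub_eq_self, smul_eq_zero]
    simp [hd0]
  obtain ⟨a, ha, ha', hda⟩ : ∃ a, mink 2 a a = -1 ∧ a ∈ futureCone ∧ 0 < mink 2 a d := by
    by_contra! h
    have h1 : ∀ x, mink 2 (e x) d ≤ 0 := fun x => h _ (he.mink_self x) (he.mem_futureCone x)
    obtain ⟨x, -⟩ := he.exists_eq (v := ((0 : EuclideanSpace ℝ (Fin 2)), (1 : ℝ)))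
      (by simp [mink_eq]) (by simp [futureCone, mink_eq])
    have h2 := h1 (σ x)
    rw [hσ, mink_sub_left, mink_smul_left, hd] at h2
    have h3 := h1 x
    have h4 : mink 2 (e x) d = 0 := by linarith
    have h5 : (2 : ℝ) • e x + d ∈ futureCone := by
      refine mem_futureCone_of_mink_neg ?_ (he.mem_futureCone x) ?_
      · simp only [mink_add_left, mink_add_right, mink_smul_left, mink_smul_right, he.mink_self,
          h4, hd, mink_comm d (e x)]
        norm_num
      · simp only [mink_add_left, mink_smul_left, he.mink_self, h4, mink_comm d (e x)]
        norm_num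
    obtain ⟨c, hc, h6⟩ := he.exists_proj_eq h5
    have h7 := h1 (he.proj ((2 : ℝ) • e x + d))
    simp only [h6, mink_smul_left, mink_add_left, h4, hd] at h7
    linarith
  obtain ⟨x, rfl⟩ := he.exists_eq ha ha'
  refine ⟨?_, ?_, ?_⟩
  · ext y
    apply he.inj
    change e (σ (σ y)) = e y
    simp only [hσ, mink_sub_left, mink_smul_left, hd]
    module
  · intro h
    refine (hfix x).2 hda.ne' ?_
    rw [h]; rfl
  · intro hpre
    have hset : {x : X | σ x ≠ x} = {x | mink 2 (e x) d ≠ 0} := by ext x; exact hfix x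
    rw [hset] at hpre
    have hc := he.continuous_mink_e d
    obtain ⟨y, hy, hy1, hy2⟩ := hpre {x | 0 < mink 2 (e x) d} {x | mink 2 (e x) d < 0}
      (isOpen_lt continuous_const hc) (isOpen_lt hc continuous_const)
      (fun y hy => (lt_or_gt_of_ne hy).symm) ⟨x, hda.ne', hda⟩
      ⟨σ x, by
        simp only [mem_ofPred_eq, hσ, mink_sub_left, mink_smul_left, hd]
        intro h; linarith, by
        simp only [mem_ofPred_eq, hσ, mink_sub_left, mink_smul_left, hd]
        linarith⟩
    exact lt_asymm (a := (0 : ℝ)) hy1 hy2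

end IsModel

theorem exists_base {C : Set X} (hC : IsHypercycleOrLine C) : ∃ B, HypercycleWithBase C B := by
  obtain ⟨P, l, hP, hl, rfl⟩ := hC
  exact ⟨_, P, l, hP, hl, rfl, rfl⟩

namespace IsModel

variable {e : X → MinkSpace} (he : IsModel e)
include he

theorem frontier_sublevel {w : MinkSpace} {t : ℝ} (ht : 0 ≤ t)
    (hw : mink 2 w w = 1 ∨ mink 2 w w = -1 ∧ 1 < t) :
    frontier {x | mink 2 (e x) w ≤ t} = {x | mink 2 (e x) w = t} := by
  have hc := he.continuous_mink_e w
  refine (frontier_le_subset_eq hc continuous_const).antisymm fun z hz => ?_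
  have hz' : mink 2 (e z) w = t := hz
  rw [frontier, (isClosed_le hc continuous_const).closure_eq]
  refine ⟨hz'.le, fun hint => ?_⟩
  have hcont : Continuous fun ε : ℝ => e z + ε • w := by fun_prop
  have hcone : ∀ᶠ ε : ℝ in nhds 0, e z + ε • w ∈ futureCone :=
    hcont.continuousAt.eventually_mem (isOpen_futureCone.mem_nhds (by
      simpa using he.mem_futureCone z))
  have hin : ∀ᶠ ε : ℝ in nhds 0, mink 2 (e (he.proj (e z + ε • w))) w ≤ t := by
    have h1 : ContinuousAt (fun ε : ℝ => he.proj (e z + ε • w)) 0 :=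
      ContinuousAt.comp (f := fun ε : ℝ => e z + ε • w) (g := he.proj)
        (he.continuousAt_proj (by simpa using he.mem_futureCone z)) hcont.continuousAt
    refine h1.eventually_mem (s := {x | mink 2 (e x) w ≤ t}) ?_
    simp only [zero_smul, add_zero, he.proj_e]
    exact mem_interior_iff_mem_nhds.1 hint
  obtain ⟨ε, ⟨hε1, hε2⟩, hε0, hε3⟩ := (((hcone.and hin).filter_mono nhdsWithin_le_nhds).and
    (Ioo_mem_nhdsGT (zero_lt_one (α := ℝ)))).exists
  have hq : mink 2 (e z + ε • w) (e z + ε • w) = -1 + 2 * ε * t + ε ^ 2 * mink 2 w w := by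
    simp only [mink_add_left, mink_add_right, mink_smul_left, mink_smul_right, he.mink_self, hz',
      mink_comm w (e z)]
    ring
  have hneg := hε1.1
  rw [he.mink_proj hε1, hq, mink_add_left, mink_smul_left, hz'] at hε2
  rw [hq] at hneg
  have hpos : 0 < -(-1 + 2 * ε * t + ε ^ 2 * mink 2 w w) := by linarith
  have hs := Real.sqrt_pos.2 hpos
  have hsq := Real.sq_sqrt hpos.le
  rw [inv_mul_le_iff₀ hs] at hε2
  set s := √(-(-1 + 2 * ε * t + ε ^ 2 * mink 2 w w))
  rcases hw with h | ⟨h, h1⟩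
  · rw [h] at hε2 hsq
    have : s < 1 := by nlinarith
    nlinarith
  · rw [h] at hε2 hsq
    have h2 : (t + ε * -1) ^ 2 ≤ (s * t) ^ 2 := pow_le_pow_left₀ (by linarith) hε2 2
    rw [mul_pow, hsq] at h2
    have h4 : 0 < (t ^ 2 - 1) * (2 * t - ε) := mul_pos (by nlinarith) (by linarith)
    nlinarith [mul_pos hε0 h4]

theorem exists_vector_of_isHalfspace {P : Set X} (hP : IsHalfspace P) :
    ∃ d : MinkSpace, mink 2 d d = 1 ∧ P = {x | mink 2 (e x) d ≤ 0} := by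
  obtain ⟨σ, hσ, hPc, hun, hin⟩ := hP
  obtain ⟨d, hd, hσd⟩ := he.exists_vector_of_isReflection hσ
  have hσm : ∀ x, mink 2 (e (σ x)) d = -mink 2 (e x) d := by
    intro x; rw [hσd, mink_sub_left, mink_smul_left, hd]; ring
  have hfix : ∀ x, mink 2 (e x) d = 0 → x ∈ P := by
    intro x hx
    have : x ∈ P ∩ σ '' P := by
      rw [hin]
      apply he.inj
      rw [hσd, hx]; simp
    exact this.1
  have hfix' : ∀ x, x ∈ P → x ∈ σ '' P → mink 2 (e x) d = 0 := by
    intro x h1 h2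
    have h3 : σ x = x := by
      have : x ∈ P ∩ σ '' P := ⟨h1, h2⟩
      rwa [hin] at this
    have := hσm x
    rw [h3] at this
    linarith
  have hcov : ∀ x, x ∈ P ∨ x ∈ σ '' P := fun x => by
    have : x ∈ P ∪ σ '' P := hun ▸ mem_univ x
    exact this
  have hmem : ∀ x, σ x ∈ σ '' P ↔ x ∈ P := fun x => σ.injective.mem_set_image
  have hor : (∀ x, 0 < mink 2 (e x) d → x ∉ P) ∨ (∀ x, 0 < mink 2 (e x) d → x ∉ σ '' P) := by
    by_contra! ⟨⟨x, hx, hx'⟩, ⟨y, hy, hy'⟩⟩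
    obtain ⟨z, hz, hz1, hz2⟩ := isPreconnected_closed_iff.1 (he.isPreconnected_halfplane d) P
      (σ '' P) hPc (σ.toHomeomorph.isClosedMap P hPc) (fun z _ => hcov z) ⟨x, hx, hx'⟩ ⟨y, hy, hy'⟩
    have hz' : 0 < mink 2 (e z) d := hz
    rw [hfix' z hz1 hz2] at hz'
    exact lt_irrefl _ hz'
  rcases hor with h | h
  · refine ⟨d, hd, Set.ext fun x => ⟨fun hx => not_lt.1 fun h' => h x h' hx, fun hx => ?_⟩⟩
    rcases lt_or_eq_of_le (show _ from hx : mink 2 (e x) d ≤ 0) with hx | hx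
    · have h1 : σ x ∉ P := h _ (by rw [hσm]; linarith)
      exact (hmem x).1 ((hcov (σ x)).resolve_left h1)
    · exact hfix x hx
  · refine ⟨-d, by simpa using hd, Set.ext fun x => ⟨fun hx => ?_, fun hx => ?_⟩⟩
    · by_contra h'
      simp only [mem_ofPred_eq, mink_neg_right, not_le, Left.neg_pos_iff] at h'
      exact h (σ x) (by rw [hσm]; linarith) ((hmem x).2 hx)
    · simp only [mem_ofPred_eq, mink_neg_right, Left.neg_nonpos_iff] at hx
      rcases hx.lt_or_eq with hx | hx
      · exact (hcov x).resolve_right (h x hx)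
      · exact hfix x hx.symm

theorem isHalfspace_of_vector {d : MinkSpace} (hd : mink 2 d d = 1) :
    IsHalfspace {x | mink 2 (e x) d ≤ 0} := by
  obtain ⟨σ, hσ⟩ := he.exists_reflectionMap hd
  have hσm : ∀ x, mink 2 (e (σ x)) d = -mink 2 (e x) d := by
    intro x; rw [hσ, mink_sub_left, mink_smul_left, hd]; ring
  have hd0 : d ≠ 0 := by rintro rfl; simp [mink_eq] at hd
  have hinv : ∀ x, σ (σ x) = x := by
    intro x
    apply he.inj
    rw [hσ, hσm, hσ]
    module
  have himg : σ '' {x | mink 2 (e x) d ≤ 0} = {x | 0 ≤ mink 2 (e x) d} := by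
    ext x
    constructor
    · rintro ⟨y, hy, rfl⟩
      simp only [mem_ofPred_eq] at hy ⊢
      rw [hσm]; linarith
    · intro hx
      refine ⟨σ x, ?_, hinv x⟩
      simp only [mem_ofPred_eq] at hx ⊢
      rw [hσm]; linarith
  refine ⟨σ, he.isReflection_of_vector hd hσ,
    isClosed_le (he.continuous_mink_e d) continuous_const, ?_, ?_⟩
  · rw [himg]
    exact eq_univ_of_forall fun x => le_total (mink 2 (e x) d) 0
  · rw [himg]
    ext x
    simp only [mem_inter_iff, mem_ofPred_eq, ← le_antisymm_iff]
    rw [← he.inj.eq_iff, hσ, sub_eq_self, smul_eq_zero]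
    simp [hd0]

theorem infDist_halfspace_le_iff {d : MinkSpace} (hd : mink 2 d d = 1) {l : ℝ} (hl : 0 ≤ l)
    (x : X) : infDist x {y | mink 2 (e y) d ≤ 0} ≤ l ↔ mink 2 (e x) d ≤ Real.sinh l := by
  rcases le_or_gt (mink 2 (e x) d) 0 with hs | hs
  · rw [infDist_zero_of_mem (s := {y | mink 2 (e y) d ≤ 0}) hs]
    exact iff_of_true hl (hs.trans (Real.sinh_nonneg_iff.2 hl))
  set s := mink 2 (e x) d with hsdef
  have hfut : ∀ y : X, e y - mink 2 (e y) d • d ∈ futureCone := by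
    intro y
    refine mem_futureCone_of_mink_neg ?_ (he.mem_futureCone y) ?_
    · simp only [mink_sub_left, mink_sub_right, mink_smul_left, mink_smul_right, he.mink_self, hd,
        mink_comm d (e y)]
      nlinarith [sq_nonneg (mink 2 (e y) d)]
    · simp only [mink_sub_left, mink_smul_left, he.mink_self, mink_comm d (e y)]
      nlinarith [sq_nonneg (mink 2 (e y) d)]
  have hqf : ∀ y : X, mink 2 (e y - mink 2 (e y) d • d) (e y - mink 2 (e y) d • d)
      = -(1 + mink 2 (e y) d ^ 2) := by
    intro y
    simp only [mink_sub_left, mink_sub_right, mink_smul_left, mink_smul_right, he.mink_self, hd,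
        mink_comm d (e y)]
    ring
  have hq := hqf x
  have hfx := hfut x
  rw [← hsdef] at hq hfx
  have hpos : 0 < 1 + s ^ 2 := by positivity
  have hsp := Real.sqrt_pos.2 hpos
  have hsq := Real.sq_sqrt hpos.le
  have has : 0 ≤ Real.arsinh s := Real.arsinh_nonneg_iff.2 hs.le
  have hfoot : he.proj (e x - s • d) ∈ {y | mink 2 (e y) d ≤ 0} := by
    simp only [mem_ofPred_eq, he.mink_proj hfx, mink_sub_left, mink_smul_left, hd, ← hsdef]
    simp
  have hdist : dist x (he.proj (e x - s • d)) ≤ Real.arsinh s := by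
    rw [he.dist_le_iff has, Real.cosh_arsinh, mink_comm, he.mink_proj hfx, hq, mink_sub_left,
      mink_smul_left, he.mink_self, mink_comm d, ← hsdef, neg_neg]
    rw [← mul_neg, inv_mul_le_iff₀ hsp]
    nlinarith
  have hge : ∀ y ∈ {y | mink 2 (e y) d ≤ 0}, Real.arsinh s ≤ dist x y := by
    intro y hy
    by_contra! h
    rw [he.dist_lt_iff has, Real.cosh_arsinh] at h
    have h1 := mink_sq_ge (u := e x - s • d) (v := e y - mink 2 (e y) d • d) hfx.1
    have h2 := mink_neg_of_futureCone hfx (hfut y)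
    rw [hq, hqf] at h1
    simp only [mink_sub_left, mink_sub_right, mink_smul_left, mink_smul_right, hd,
      mink_comm d (e y), ← hsdef] at h1 h2
    simp only [mem_ofPred_eq] at hy
    set t := mink 2 (e y) d
    set m := mink 2 (e x) (e y)
    have h3 : 0 ≤ -(s * t) := by nlinarith
    have h4 : -(m - s * t) < √(1 + s ^ 2) := by linarith
    have h5 : (-(m - s * t)) ^ 2 < √(1 + s ^ 2) ^ 2 :=
      pow_lt_pow_left₀ h4 (by linarith) two_ne_zero
    rw [hsq] at h5
    nlinarith [mul_nonneg hpos.le (sq_nonneg t)]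
  have : infDist x {y | mink 2 (e y) d ≤ 0} = Real.arsinh s :=
    ((infDist_le_dist_of_mem hfoot).trans hdist).antisymm ((le_infDist ⟨_, hfoot⟩).2 fun y hy => hge y hy)
  rw [this, ← Real.sinh_le_sinh, Real.sinh_arsinh]

theorem frontier_infDist_halfspace {d : MinkSpace} (hd : mink 2 d d = 1) {l : ℝ} (hl : 0 ≤ l) :
    frontier {x | infDist x {y | mink 2 (e y) d ≤ 0} ≤ l}
      = {x | mink 2 (e x) d = Real.sinh l} := by
  simp only [he.infDist_halfspace_le_iff hd hl]
  exact he.frontier_sublevel (Real.sinh_nonneg_iff.2 hl) (Or.inl hd)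

theorem hypercycleWithBase_iff {C B : Set X} : HypercycleWithBase C B ↔
    ∃ (d : MinkSpace) (t : ℝ), mink 2 d d = 1 ∧ 0 ≤ t ∧ C = {x | mink 2 (e x) d = t} ∧
      B = {x | mink 2 (e x) d = 0} := by
  constructor
  · rintro ⟨P, l, hP, hl, rfl, rfl⟩
    obtain ⟨d, hd, rfl⟩ := he.exists_vector_of_isHalfspace hP
    exact ⟨d, Real.sinh l, hd, Real.sinh_nonneg_iff.2 hl, he.frontier_infDist_halfspace hd hl,
      he.frontier_sublevel le_rfl (Or.inl hd)⟩
  · rintro ⟨d, t, hd, ht, rfl, rfl⟩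
    refine ⟨_, Real.arsinh t, he.isHalfspace_of_vector hd, Real.arsinh_nonneg_iff.2 ht,
      he.frontier_sublevel le_rfl (Or.inl hd), ?_⟩
    rw [he.frontier_infDist_halfspace hd (Real.arsinh_nonneg_iff.2 ht), Real.sinh_arsinh]

end IsModel

/-- A parametrization of the curve cut out of the hyperboloid by the plane through `z`
orthogonal to `w`. -/
noncomputable def levelCurve (w z : MinkSpace) (s : ℝ) : MinkSpace :=
  (mink 2 w w * mink 2 z w) • w + √(1 + mink 2 w w * s ^ 2) • (z - (mink 2 w w * mink 2 z w) • w)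
    + s • cross w z

theorem levelCurve_zero (w z : MinkSpace) : levelCurve w z 0 = z := by
  simp [levelCurve]

theorem continuous_levelCurve (w z : MinkSpace) : Continuous (levelCurve w z) := by
  unfold levelCurve
  fun_prop

theorem mink_levelCurve_left {w : MinkSpace} (hw : mink 2 w w * mink 2 w w = 1) (z : MinkSpace)
    (s : ℝ) : mink 2 (levelCurve w z s) w = mink 2 z w := by
  simp only [levelCurve, mink_add_left, mink_smul_left, mink_sub_left, mink_cross_left]
  linear_combination (mink 2 z w - √(1 + mink 2 w w * s ^ 2) * mink 2 z w) * hw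

theorem mink_levelCurve_right {w z : MinkSpace} (hz : mink 2 z z = -1) (s : ℝ) :
    mink 2 (levelCurve w z s) z = mink 2 w w * mink 2 z w ^ 2
      - √(1 + mink 2 w w * s ^ 2) * (1 + mink 2 w w * mink 2 z w ^ 2) := by
  simp only [levelCurve, mink_add_left, mink_smul_left, mink_sub_left, mink_cross_right, hz,
    mink_comm w z]
  ring

theorem mink_levelCurve_cross {w z : MinkSpace} (hz : mink 2 z z = -1) (s : ℝ) :
    mink 2 (levelCurve w z s) (cross w z) = s * (mink 2 w w + mink 2 z w ^ 2) := by
  simp only [levelCurve, mink_add_left, mink_smul_left, mink_sub_left, mink_comm w (cross w z),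
    mink_comm z (cross w z), mink_cross_right, mink_cross_left, mink_cross_cross, hz, mink_comm w z]
  ring

theorem mink_self_levelCurve {w z : MinkSpace} (hw : mink 2 w w * mink 2 w w = 1)
    (hz : mink 2 z z = -1) {s : ℝ} (hs : 0 ≤ 1 + mink 2 w w * s ^ 2) :
    mink 2 (levelCurve w z s) (levelCurve w z s) = -1 := by
  conv_lhs => enter [3]; rw [levelCurve]
  rw [mink_add_right, mink_add_right, mink_smul_right, mink_smul_right, mink_smul_right,
    mink_sub_right, mink_smul_right, mink_levelCurve_left hw, mink_levelCurve_right hz,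
    mink_levelCurve_cross hz]
  have h := Real.sq_sqrt hs
  set c := √(1 + mink 2 w w * s ^ 2)
  linear_combination (-1 - mink 2 w w * mink 2 z w ^ 2) * h - mink 2 z w ^ 2 * s ^ 2 * hw

namespace IsModel

variable {e : X → MinkSpace} (he : IsModel e)
include he

theorem cross_eq_zero_of_uncountable {S : Set X} (hS : ¬ S.Countable) {u v : MinkSpace} {a b : ℝ}
    (hu : ∀ x ∈ S, mink 2 (e x) u = a) (hv : ∀ x ∈ S, mink 2 (e x) v = b) : cross u v = 0 := by
  by_contra hk
  obtain ⟨x0, hx0⟩ : S.Nonempty := by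
    by_contra h
    exact hS (not_nonempty_iff_eq_empty.1 h ▸ countable_empty)
  apply hS
  set k := cross u v with hkdef
  set c := -(2 * mink 2 (e x0) k) / mink 2 k k with hc
  refine Set.Countable.mono ?_ ((Set.toFinite {e x0, e x0 + c • k}).preimage
    he.inj.injOn).countable
  intro x hx
  obtain ⟨l, hl⟩ := parallel_cross hk (h := e x - e x0)
    (by rw [mink_sub_left, hu x hx, hu x0 hx0, sub_self])
    (by rw [mink_sub_left, hv x hx, hv x0 hx0, sub_self])
  rw [← hkdef] at hl
  have hx' : e x = e x0 + l • k := by rw [← hl]; abel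
  have hq := he.mink_self x
  rw [hx'] at hq
  simp only [mink_add_left, mink_add_right, mink_smul_left, mink_smul_right, he.mink_self,
    mink_comm k (e x0)] at hq
  have h0 : l * (2 * mink 2 (e x0) k + l * mink 2 k k) = 0 := by linarith
  simp only [mem_preimage, mem_insert_iff, mem_singleton_iff]
  rcases mul_eq_zero.1 h0 with h | h
  · left; rw [hx', h]; simp
  · right
    rw [hx']
    by_cases hkk : mink 2 k k = 0
    · rw [hkk] at h
      have := mink_self_pos_of_orth (he.mem_futureCone x0).1
        (by rw [mink_comm]; linarith : mink 2 k (e x0) = 0) hk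
      exact absurd hkk this.ne'
    · have : l = c := by rw [hc, eq_div_iff hkk]; linarith
      rw [this]

theorem exists_levelCurve {w : MinkSpace} {z : X} {s : ℝ}
    (hw : mink 2 w w = 1 ∨ mink 2 w w = -1 ∧ 1 < mink 2 (e z) w ^ 2 ∧ s ^ 2 ≤ 1) :
    levelCurve w (e z) s ∈ futureCone ∧
      e (he.proj (levelCurve w (e z) s)) = levelCurve w (e z) s := by
  have hw2 : mink 2 w w * mink 2 w w = 1 := by rcases hw with h | ⟨h, -⟩ <;> rw [h] <;> norm_num
  have hs : 0 ≤ 1 + mink 2 w w * s ^ 2 := by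
    rcases hw with h | ⟨h, h1, h2⟩ <;> rw [h]
    · positivity
    · linarith
  have hq := mink_self_levelCurve hw2 (he.mink_self z) hs
  have hmem : levelCurve w (e z) s ∈ futureCone := by
    refine mem_futureCone_of_mink_neg (by rw [hq]; norm_num) (he.mem_futureCone z) ?_
    rw [mink_levelCurve_right (he.mink_self z)]
    have h3 := Real.sqrt_nonneg (1 + mink 2 w w * s ^ 2)
    have h4 := Real.sq_sqrt hs
    set c := √(1 + mink 2 w w * s ^ 2)
    rcases hw with h | ⟨h, h1, h2⟩ <;> rw [h] at h4 ⊢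
    · have : 1 ≤ c := by nlinarith [sq_nonneg s]
      nlinarith [sq_nonneg (mink 2 (e z) w)]
    · have : c ≤ 1 := by nlinarith [sq_nonneg s]
      nlinarith
  exact ⟨hmem, he.e_proj_of_mink_self hmem hq⟩

theorem not_countable_level {w : MinkSpace} {z : X}
    (hw : mink 2 w w = 1 ∨ mink 2 w w = -1 ∧ 1 < mink 2 (e z) w ^ 2) {U : Set X}
    (hU : U ∈ nhds z) : ¬ ({x | mink 2 (e x) w = mink 2 (e z) w} ∩ U).Countable := by
  intro hcount
  have hw2 : mink 2 w w * mink 2 w w = 1 := by rcases hw with h | ⟨h, -⟩ <;> rw [h] <;> norm_num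
  have hD : 0 < mink 2 w w + mink 2 (e z) w ^ 2 := by
    rcases hw with h | ⟨h, h1⟩ <;> rw [h]
    · positivity
    · linarith
  have hcont : ContinuousAt (fun s => he.proj (levelCurve w (e z) s)) 0 :=
    ContinuousAt.comp (f := levelCurve w (e z)) (g := he.proj)
      (he.continuousAt_proj (by rw [levelCurve_zero]; exact he.mem_futureCone z))
      (continuous_levelCurve w (e z)).continuousAt
  have hmem := hcont.preimage_mem_nhds (t := U) (by rwa [levelCurve_zero, he.proj_e])
  obtain ⟨δ, hδ, hsub⟩ := Metric.mem_nhds_iff.1 hmem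
  have hlc : ∀ s ∈ Ioo 0 (min δ 1),
      e (he.proj (levelCurve w (e z) s)) = levelCurve w (e z) s := by
    intro s hs
    have h1 : s < 1 := hs.2.trans_le (min_le_right _ _)
    have h2 : s ^ 2 ≤ 1 := by nlinarith [hs.1]
    exact (he.exists_levelCurve (hw.imp id fun h => ⟨h.1, h.2, h2⟩)).2
  have hmaps : MapsTo (fun s => he.proj (levelCurve w (e z) s)) (Ioo 0 (min δ 1))
      ({x | mink 2 (e x) w = mink 2 (e z) w} ∩ U) := by
    intro s hs
    refine ⟨?_, hsub ?_⟩
    · simp only [mem_ofPred_eq, hlc s hs]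
      exact mink_levelCurve_left hw2 _ _
    · rw [mem_ball, dist_zero_right, Real.norm_of_nonneg hs.1.le]
      exact hs.2.trans_le (min_le_left _ _)
  have hinj : InjOn (fun s => he.proj (levelCurve w (e z) s)) (Ioo 0 (min δ 1)) := by
    intro s hs s' hs' h
    have h1 := congrArg (fun x => mink 2 (e x) (cross w (e z))) h
    simp only [hlc s hs, hlc s' hs', mink_levelCurve_cross (he.mink_self z)] at h1
    exact mul_right_cancel₀ hD.ne' h1
  have := hmaps.countable_of_injOn hinj hcount
  have hlt : (0 : ℝ) < min δ 1 := lt_min hδ one_pos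
  exact absurd (Cardinal.Real.Ioo_countable_iff.1 this) (not_le.2 hlt)

/-- Hypercycles are unbounded. -/
theorem exists_far_level {w : MinkSpace} (hw : mink 2 w w = 1) (z : X) (R : ℝ) :
    ∃ x, mink 2 (e x) w = mink 2 (e z) w ∧ R < dist z x := by
  have h := (he.exists_levelCurve (w := w) (z := z) (s := Real.sinh (|R| + 1)) (Or.inl hw)).2
  refine ⟨_, by rw [h, mink_levelCurve_left (by rw [hw]; norm_num)], (le_abs_self R).trans_lt ?_⟩
  rw [← not_le, he.dist_le_iff (abs_nonneg R), not_le, mink_comm, h,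
    mink_levelCurve_right (he.mink_self z), hw, one_mul, one_mul, ← Real.cosh_sq',
    Real.sqrt_sq (Real.cosh_pos _).le]
  have h1 : Real.cosh |R| < Real.cosh (|R| + 1) := by
    have h0 := abs_nonneg R
    rw [Real.cosh_lt_cosh, abs_abs, abs_of_pos (by linarith : 0 < |R| + 1)]; linarith
  have h2 := Real.one_le_cosh (|R| + 1)
  nlinarith [sq_nonneg (mink 2 (e z) w)]

theorem eq_of_mink_eq {x y : X} (h : mink 2 (e x) (e y) = -1) : x = y := by
  have := (he.dist_eq_iff (x := x) (y := y) le_rfl).2 (by rw [h]; simp)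
  exact dist_eq_zero.1 this

theorem uniqueBtwPt_of_combo {x y z : X} {α β : ℝ} (hα : 0 ≤ α) (hβ : 0 ≤ β)
    (hz : e z = α • e x + β • e y) : UniqueBtwPt x z y := by
  have hk := he.cosh_dist x y
  have ha := he.cosh_dist x z
  have hb := he.cosh_dist z y
  have h1 := he.mink_self z
  have hsD := Real.cosh_sq (dist x y)
  have hsa := Real.cosh_sq (dist x z)
  have hsb := Real.cosh_sq (dist z y)
  have pD := Real.sinh_nonneg_iff.2 (dist_nonneg (x := x) (y := y))
  have pa := Real.sinh_nonneg_iff.2 (dist_nonneg (x := x) (y := z))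
  have pb := Real.sinh_nonneg_iff.2 (dist_nonneg (x := z) (y := y))
  rw [hz] at ha hb h1
  simp only [mink_add_left, mink_add_right, mink_smul_left, mink_smul_right, he.mink_self,
    mink_comm (e y) (e x)] at ha hb h1
  rw [show mink 2 (e x) (e y) = -Real.cosh (dist x y) by linarith] at ha hb h1
  have hsum : dist x z + dist z y = dist x y := by
    have e1 : Real.sinh (dist x z) = β * Real.sinh (dist x y) := by
      refine (sq_eq_sq₀ pa (mul_nonneg hβ pD)).1 ?_
      rw [ha] at hsa
      linear_combination -hsa - h1 + β ^ 2 * hsD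
    have e2 : Real.sinh (dist z y) = α * Real.sinh (dist x y) := by
      refine (sq_eq_sq₀ pb (mul_nonneg hα pD)).1 ?_
      rw [hb] at hsb
      linear_combination -hsb - h1 + α ^ 2 * hsD
    have e3 : Real.cosh (dist x z + dist z y) = Real.cosh (dist x y) := by
      rw [Real.cosh_add, e1, e2, ha, hb]
      linear_combination -Real.cosh (dist x y) * h1 - α * β * hsD
    exact Real.cosh_strictMonoOn.injOn (add_nonneg dist_nonneg dist_nonneg)
      (dist_nonneg (x := x) (y := y)) e3
  refine ⟨hsum, fun w hw hxw => ?_⟩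
  have hwy : dist w y = dist z y := by unfold Btw at hw; linarith
  have c1 := he.cosh_dist x w
  have c2 := he.cosh_dist w y
  rw [hxw, he.cosh_dist] at c1
  rw [hwy, he.cosh_dist] at c2
  apply he.eq_of_mink_eq
  have := he.mink_self z
  rw [hz] at this c1 c2 ⊢
  simp only [mink_add_left, mink_add_right, mink_smul_left, mink_smul_right, he.mink_self,
    mink_comm (e w) (e x), mink_comm (e y) (e x)] at c1 c2 this ⊢
  linear_combination this + α * c1 + β * c2

theorem mem_of_combo {L : Set X} (hL : GConvex L) {x y z : X} (hx : x ∈ L) (hy : y ∈ L) {α β : ℝ}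
    (hα : 0 ≤ α) (hβ : 0 ≤ β) (hz : e z = α • e x + β • e y) : z ∈ L :=
  hL x hx y hy z (he.uniqueBtwPt_of_combo hα hβ hz)

theorem proj_smul_e (x : X) {c : ℝ} (hc : 0 < c) : he.proj (c • e x) = x := by
  apply he.inj
  rw [he.e_proj (smul_mem_futureCone (he.mem_futureCone x) hc)]
  simp only [mink_smul_left, mink_smul_right, he.mink_self]
  rw [show -(c * (c * -1)) = c ^ 2 by ring, Real.sqrt_sq hc.le, smul_smul, inv_mul_cancel₀ hc.ne',
    one_smul]

theorem convex_cone {L : Set X} (hL : GConvex L) :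
    Convex ℝ {v : MinkSpace | v ∈ futureCone ∧ he.proj v ∈ L} := by
  rw [convex_iff_forall_pos]
  rintro u ⟨hu, hu'⟩ v ⟨hv, hv'⟩ a b ha hb -
  have h := add_mem_futureCone (smul_mem_futureCone hu ha) (smul_mem_futureCone hv hb)
  refine ⟨h, ?_⟩
  obtain ⟨c, hc, h0⟩ := he.exists_proj_eq h
  obtain ⟨c1, hc1, h1⟩ := he.exists_proj_eq hu
  obtain ⟨c2, hc2, h2⟩ := he.exists_proj_eq hv
  refine he.mem_of_combo hL hu' hv' (α := c * a / c1) (β := c * b / c2) (by positivity)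
    (by positivity) ?_
  rw [h0, h1, h2, smul_smul, smul_smul, div_mul_cancel₀ _ hc1.ne', div_mul_cancel₀ _ hc2.ne']
  module

theorem mem_interior_of_combo {L : Set X} (hL : GConvex L) {p y z : X} (hp : p ∈ interior L)
    (hy : y ∈ L) {α β : ℝ} (hα : 0 < α) (hβ : 0 ≤ β) (hz : e z = α • e p + β • e y) :
    z ∈ interior L := by
  have hpc : e p ∈ interior {v : MinkSpace | v ∈ futureCone ∧ he.proj v ∈ L} := by
    rw [mem_interior_iff_mem_nhds]
    have hpf := he.mem_futureCone p
    filter_upwards [isOpen_futureCone.mem_nhds hpf, (he.continuousAt_proj hpf).preimage_mem_nhds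
      (t := L) (by rw [he.proj_e]; exact mem_interior_iff_mem_nhds.1 hp)] with v h1 h2 using ⟨h1, h2⟩
  have hs : 0 < α + β := by positivity
  have hu := (he.convex_cone hL).combo_interior_self_mem_interior hpc
    (show e y ∈ _ from ⟨he.mem_futureCone y, by rwa [he.proj_e]⟩) (div_pos hα hs)
    (div_nonneg hβ hs.le) (by field_simp)
  have heq : (α + β)⁻¹ • e z = (α / (α + β)) • e p + (β / (α + β)) • e y := by
    rw [hz]; module
  rw [← heq] at hu
  have hopen : IsOpen ((fun x => (α + β)⁻¹ • e x) ⁻¹'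
      interior {v : MinkSpace | v ∈ futureCone ∧ he.proj v ∈ L}) :=
    isOpen_interior.preimage (by have := he.continuous_e; fun_prop)
  refine interior_maximal ?_ hopen hu
  intro x hx
  have := (interior_subset hx).2
  rwa [he.proj_smul_e x (inv_pos.2 hs)] at this

theorem subset_closure_interior {L : Set X} (hL : GConvex L) (hint : (interior L).Nonempty) :
    L ⊆ closure (interior L) := by
  obtain ⟨p, hp⟩ := hint
  intro y hy
  have hc : Continuous fun s : ℝ => s • e p + (1 : ℝ) • e y := by fun_prop
  have hcont : ContinuousAt (fun s : ℝ => he.proj (s • e p + (1 : ℝ) • e y)) 0 :=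
    ContinuousAt.comp (f := fun s : ℝ => s • e p + (1 : ℝ) • e y) (g := he.proj)
      (he.continuousAt_proj (by simpa using he.mem_futureCone y)) hc.continuousAt
  have ht : Tendsto (fun s : ℝ => he.proj (s • e p + (1 : ℝ) • e y)) (nhdsWithin 0 (Ioi 0))
      (nhds y) := by
    have := hcont.tendsto
    simp only [zero_smul, one_smul, zero_add, he.proj_e] at this
    simp only [one_smul]
    exact this.mono_left nhdsWithin_le_nhds
  refine mem_closure_of_tendsto ht ?_
  filter_upwards [self_mem_nhdsWithin] with s hs
  have hf := add_mem_futureCone (smul_mem_futureCone (he.mem_futureCone p) hs)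
    (smul_mem_futureCone (he.mem_futureCone y) one_pos)
  obtain ⟨c, hc, h⟩ := he.exists_proj_eq hf
  refine he.mem_interior_of_combo hL hp hy (α := c * s) (β := c) (mul_pos hc hs) hc.le ?_
  rw [h]; module

theorem exists_combo_eq_zero {f : X → ℝ} (hf : Continuous f) {x y : X} (hx : f x < 0)
    (hy : 0 < f y) : ∃ (z : X) (α β : ℝ), 0 < α ∧ 0 < β ∧ e z = α • e x + β • e y ∧ f z = 0 := by
  have hcone : ∀ s ∈ Icc (0 : ℝ) 1, (1 - s) • e x + s • e y ∈ futureCone := by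
    rintro s ⟨h0, h1⟩
    rcases h0.eq_or_lt with rfl | h0
    · simpa using he.mem_futureCone x
    rcases h1.eq_or_lt with rfl | h1
    · simpa using he.mem_futureCone y
    exact add_mem_futureCone (smul_mem_futureCone (he.mem_futureCone x) (sub_pos.2 h1))
      (smul_mem_futureCone (he.mem_futureCone y) h0)
  have hc : Continuous fun s : ℝ => (1 - s) • e x + s • e y := by fun_prop
  have hcont : ContinuousOn (fun s : ℝ => f (he.proj ((1 - s) • e x + s • e y))) (Icc 0 1) :=
    hf.comp_continuousOn (he.continuousOn_proj.comp hc.continuousOn hcone)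
  have hiv := intermediate_value_Icc zero_le_one hcont
  simp only [sub_zero, one_smul, zero_smul, add_zero, sub_self, zero_add, he.proj_e] at hiv
  obtain ⟨s, hs, hs0⟩ := hiv ⟨hx.le, hy.le⟩
  obtain ⟨c, hc0, h⟩ := he.exists_proj_eq (hcone s hs)
  have hs0' : f (he.proj ((1 - s) • e x + s • e y)) = 0 := hs0
  have hne0 : s ≠ 0 := by
    rintro rfl
    simp only [sub_zero, one_smul, zero_smul, add_zero, he.proj_e] at hs0'
    exact hx.ne hs0'
  have hne1 : s ≠ 1 := by
    rintro rfl
    simp only [one_smul, zero_smul, sub_self, zero_add, he.proj_e] at hs0'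
    exact hy.ne' hs0'
  have h1 : 0 < 1 - s := sub_pos.2 (lt_of_le_of_ne hs.2 hne1)
  have h2 : 0 < s := lt_of_le_of_ne hs.1 (Ne.symm hne0)
  refine ⟨_, c * (1 - s), c * s, mul_pos hc0 h1, mul_pos hc0 h2, ?_, hs0'⟩
  rw [h]; module

/-- A convex set with a hypercycle in its frontier lies on one side of this hypercycle. -/
theorem one_sided {L : Set X} (hL : GConvex L) (hint : (interior L).Nonempty) {w : MinkSpace}
    {t : ℝ} (hsub : {x | mink 2 (e x) w = t} ⊆ frontier L) :
    (∀ x ∈ L, mink 2 (e x) w ≤ t) ∨ ∀ x ∈ L, t ≤ mink 2 (e x) w := by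
  obtain ⟨p, hp⟩ := hint
  have hd : ∀ z ∈ interior L, mink 2 (e z) w ≠ t := fun z hz h => (hsub h).2 hz
  have hc : Continuous fun x => mink 2 (e x) w - t := (he.continuous_mink_e w).sub continuous_const
  rcases lt_or_gt_of_ne (hd p hp) with h | h
  · left
    intro y hy
    by_contra! hlt
    obtain ⟨z, α, β, hα, hβ, hz, h0⟩ := he.exists_combo_eq_zero hc (x := p) (y := y)
      (by linarith) (by linarith)
    exact hd z (he.mem_interior_of_combo hL hp hy hα hβ.le hz) (by linarith)
  · right
    intro y hy
    by_contra! hlt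
    obtain ⟨z, α, β, hα, hβ, hz, h0⟩ := he.exists_combo_eq_zero hc (x := y) (y := p)
      (by linarith) (by linarith)
    exact hd z (he.mem_interior_of_combo hL hp hy hβ hα.le (by rw [hz, add_comm])) (by linarith)

/-- Polar coordinates with respect to the line orthogonal to `d`. -/
theorem exists_polar {d : MinkSpace} (hd : mink 2 d d = 1) (z : X) :
    ∃ (S : ℝ) (m : X), mink 2 (e m) d = 0 ∧ e z = Real.sinh S • d + Real.cosh S • e m := by
  obtain ⟨S, hS⟩ := Real.sinh_surjective (mink 2 (e z) d)
  have hC := Real.cosh_pos S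
  have hsq := Real.cosh_sq S
  have hq : mink 2 ((Real.cosh S)⁻¹ • (e z - Real.sinh S • d))
      ((Real.cosh S)⁻¹ • (e z - Real.sinh S • d)) = -1 := by
    simp only [mink_sub_left, mink_sub_right, mink_smul_left, mink_smul_right, he.mink_self, hd,
      mink_comm d (e z), ← hS]
    field_simp
    linarith
  obtain ⟨m, hm⟩ := he.exists_eq hq (mem_futureCone_of_mink_neg (by rw [hq]; norm_num)
    (he.mem_futureCone z) (by
      simp only [mink_sub_left, mink_smul_left, he.mink_self, mink_comm d (e z), ← hS]
      exact mul_neg_of_pos_of_neg (inv_pos.2 hC) (by nlinarith [sq_nonneg (Real.sinh S)])))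
  refine ⟨S, m, ?_, ?_⟩
  · rw [hm]
    simp only [mink_sub_left, mink_smul_left, hd, ← hS]
    ring
  · rw [hm, smul_smul, mul_inv_cancel₀ hC.ne']
    module

theorem exists_of_polar {d : MinkSpace} (hd : mink 2 d d = 1) {m : X} (hm : mink 2 (e m) d = 0)
    (S : ℝ) : ∃ z, e z = Real.sinh S • d + Real.cosh S • e m := by
  have hsq := Real.cosh_sq S
  have hq : mink 2 (Real.sinh S • d + Real.cosh S • e m) (Real.sinh S • d + Real.cosh S • e m)
      = -1 := by
    simp only [mink_add_left, mink_add_right, mink_smul_left, mink_smul_right, he.mink_self, hd,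
      mink_comm d (e m), hm]
    linarith
  refine he.exists_eq hq (mem_futureCone_of_mink_neg (by rw [hq]; norm_num)
    (he.mem_futureCone m) ?_)
  simp only [mink_add_left, mink_smul_left, he.mink_self, mink_comm d (e m), hm]
  linarith [Real.cosh_pos S]

theorem exists_mink_eq {d : MinkSpace} (hd : mink 2 d d = 1) (t : ℝ) :
    ∃ x, mink 2 (e x) d = t := by
  obtain ⟨x0, -⟩ := he.exists_eq (v := ((0 : EuclideanSpace ℝ (Fin 2)), (1 : ℝ)))
      (by simp [mink_eq]) (by simp [futureCone, mink_eq])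
  obtain ⟨S, m, hm, -⟩ := he.exists_polar hd x0
  obtain ⟨T, rfl⟩ := Real.sinh_surjective t
  obtain ⟨z, hz⟩ := he.exists_of_polar hd hm T
  refine ⟨z, ?_⟩
  rw [hz, mink_add_left, mink_smul_left, mink_smul_left, hd, hm]
  ring

theorem isGeodesicLine_of_vector {d : MinkSpace} (hd : mink 2 d d = 1) :
    IsGeodesicLine {x | mink 2 (e x) d = 0} := by
  obtain ⟨a, ha⟩ := he.exists_mink_eq hd 0
  have haa := he.mink_self a
  have hda : mink 2 d (e a) = 0 := by rw [mink_comm, ha]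
  have hkk := mink_self_cross hd haa hda
  have hexp := orthonormal_expansion hd haa hda
  have hkd : mink 2 (cross d (e a)) d = 0 := mink_cross_left _ _
  have hka : mink 2 (cross d (e a)) (e a) = 0 := mink_cross_right _ _
  set k := cross d (e a)
  choose γ hγ using he.exists_of_polar hkk (m := a) (by rw [mink_comm]; exact hka)
  refine ⟨γ, Isometry.of_dist_eq fun s t => ?_, ?_⟩
  · rw [he.dist_eq_iff dist_nonneg, Real.dist_eq, Real.cosh_abs, Real.cosh_sub, hγ, hγ]
    simp only [mink_add_left, mink_add_right, mink_smul_left, mink_smul_right, hkk, haa, hka,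
      mink_comm (e a) k]
    ring
  · ext x
    constructor
    · intro hx
      have hx' : mink 2 (e x) d = 0 := hx
      have hxe := hexp (e x)
      rw [hx'] at hxe
      refine ⟨Real.arsinh (mink 2 (e x) k), he.inj ?_⟩
      have h1 := he.mink_self x
      have h2 := he.mink_le x a
      conv_lhs at h1 => rw [hxe]
      simp only [mink_add_left, mink_add_right, mink_smul_left, mink_smul_right, mink_sub_left,
        mink_sub_right, hkk, haa, hka, hkd, hda, mink_comm (e a) k, zero_mul, zero_sub] at h1
      rw [hγ, Real.sinh_arsinh, Real.cosh_arsinh,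
        show 1 + mink 2 (e x) k ^ 2 = (-mink 2 (e x) (e a)) ^ 2 by linarith,
        Real.sqrt_sq (by linarith)]
      conv_rhs => rw [hxe]
      module
    · rintro ⟨s, rfl⟩
      simp only [mem_ofPred_eq, hγ, mink_add_left, mink_smul_left, hkd, mink_comm (e a) d, hda]
      simp

theorem parallel_of_base_eq {d d' : MinkSpace} (hd : mink 2 d d = 1) (hd' : mink 2 d' d' = 1)
    (h : {x | mink 2 (e x) d = 0} = {x | mink 2 (e x) d' = 0}) : d' = d ∨ d' = -d := by
  obtain ⟨z, hz⟩ := he.exists_mink_eq hd 0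
  have hunc := he.not_countable_level (z := z) (Or.inl hd) (U := univ) univ_mem
  rw [hz, inter_univ] at hunc
  have hc := he.cross_eq_zero_of_uncountable hunc (u := d) (v := d') (a := 0) (b := 0)
    (fun x hx => hx) (fun x hx => by rw [h] at hx; exact hx)
  obtain ⟨c, rfl⟩ := parallel_of_cross_eq_zero hc (by rintro rfl; simp [mink_eq] at hd)
  rw [mink_smul_left, mink_smul_right, hd] at hd'
  rcases mul_self_eq_one_iff.1 (by linarith : c * c = 1) with rfl | rfl
  · left; simp
  · right; simp

theorem strip_subset {L : Set X} (hL : GConvex L) {d : MinkSpace} (hd : mink 2 d d = 1) {a b : ℝ}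
    (hab : a < b) (ha : {x | mink 2 (e x) d = a} ⊆ L) (hb : {x | mink 2 (e x) d = b} ⊆ L) {z : X}
    (hza : a ≤ mink 2 (e z) d) (hzb : mink 2 (e z) d ≤ b) : z ∈ L := by
  obtain ⟨A, rfl⟩ := Real.sinh_surjective a
  obtain ⟨B, rfl⟩ := Real.sinh_surjective b
  obtain ⟨S, m, hm, hz⟩ := he.exists_polar hd z
  obtain ⟨x, hx⟩ := he.exists_of_polar hd hm A
  obtain ⟨y, hy⟩ := he.exists_of_polar hd hm B
  have hval : ∀ (w : X) (W : ℝ), e w = Real.sinh W • d + Real.cosh W • e m →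
      mink 2 (e w) d = Real.sinh W := by
    intro w W h
    rw [h, mink_add_left, mink_smul_left, mink_smul_left, hd, hm]
    ring
  rw [hval z S hz, Real.sinh_le_sinh] at hza hzb
  rw [Real.sinh_lt_sinh] at hab
  have hpos : 0 < Real.sinh (B - A) := Real.sinh_pos_iff.2 (sub_pos.2 hab)
  refine he.mem_of_combo hL (ha (hval x A hx)) (hb (hval y B hy))
    (α := Real.sinh (B - S) / Real.sinh (B - A)) (β := Real.sinh (S - A) / Real.sinh (B - A))
    (div_nonneg (Real.sinh_nonneg_iff.2 (sub_nonneg.2 hzb)) hpos.le)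
    (div_nonneg (Real.sinh_nonneg_iff.2 (sub_nonneg.2 hza)) hpos.le) ?_
  have e1 : Real.sinh (B - S) / Real.sinh (B - A) * Real.sinh A
      + Real.sinh (S - A) / Real.sinh (B - A) * Real.sinh B = Real.sinh S := by
    field_simp
    simp only [Real.sinh_sub]
    ring
  have e2 : Real.sinh (B - S) / Real.sinh (B - A) * Real.cosh A
      + Real.sinh (S - A) / Real.sinh (B - A) * Real.cosh B = Real.cosh S := by
    field_simp
    simp only [Real.sinh_sub]
    ring
  rw [hz, hx, hy, ← e1, ← e2]
  module

theorem frontier_eq_of_strip {L : Set X} (hLcl : IsClosed L) (hL : GConvex L)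
    (hint : (interior L).Nonempty) {d : MinkSpace} (hd : mink 2 d d = 1) {a b : ℝ} (hab : a < b)
    (ha : {x | mink 2 (e x) d = a} ⊆ frontier L) (hb : {x | mink 2 (e x) d = b} ⊆ frontier L) :
    frontier L = {x | mink 2 (e x) d = a} ∪ {x | mink 2 (e x) d = b} := by
  refine Subset.antisymm (fun z hz => ?_) (union_subset ha hb)
  have hfL := hLcl.frontier_subset
  obtain ⟨xa, hxa⟩ := he.exists_mink_eq hd a
  obtain ⟨xb, hxb⟩ := he.exists_mink_eq hd b
  have h1 : ∀ x ∈ L, a ≤ mink 2 (e x) d := by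
    refine (he.one_sided hL hint ha).resolve_left fun h => ?_
    have := h xb (hfL (hb hxb))
    linarith
  have h2 : ∀ x ∈ L, mink 2 (e x) d ≤ b := by
    refine (he.one_sided hL hint hb).resolve_right fun h => ?_
    have := h xa (hfL (ha hxa))
    linarith
  by_contra hcon
  simp only [mem_union, mem_ofPred_eq, not_or] at hcon
  have hzL := hfL hz
  refine hz.2 (interior_maximal (t := {x | a < mink 2 (e x) d} ∩ {x | mink 2 (e x) d < b})
    (fun x hx => he.strip_subset hL hd hab (ha.trans hfL) (hb.trans hfL) hx.1.le hx.2.le)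
    ((isOpen_lt continuous_const (he.continuous_mink_e d)).inter
      (isOpen_lt (he.continuous_mink_e d) continuous_const))
    ⟨lt_of_le_of_ne (h1 z hzL) (Ne.symm hcon.1), lt_of_le_of_ne (h2 z hzL) hcon.2⟩)

theorem twoHypSameBase_of_common_base {L : Set X} (hLcl : IsClosed L) (hL : GConvex L)
    (hint : (interior L).Nonempty) {C₁ C₂ B : Set X} (hne : C₁ ≠ C₂) (h1 : C₁ ⊆ frontier L)
    (h2 : C₂ ⊆ frontier L) (hB1 : HypercycleWithBase C₁ B) (hB2 : HypercycleWithBase C₂ B) :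
    TwoHypSameBase L := by
  obtain ⟨d, a, hd, -, hC1, hB⟩ := he.hypercycleWithBase_iff.1 hB1
  obtain ⟨d', b', hd', -, hC2', hB'⟩ := he.hypercycleWithBase_iff.1 hB2
  obtain ⟨b, hC2⟩ : ∃ b, C₂ = {x | mink 2 (e x) d = b} := by
    rcases he.parallel_of_base_eq hd hd' (hB.symm.trans hB') with rfl | rfl
    · exact ⟨b', hC2'⟩
    · refine ⟨-b', ?_⟩
      rw [hC2']
      ext x
      simp only [mem_ofPred_eq, mink_neg_right]
      exact neg_eq_iff_eq_neg
  refine ⟨B, C₁, C₂, hB ▸ he.isGeodesicLine_of_vector hd, hne, hB1, hB2, ?_⟩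
  have hab : a ≠ b := by
    rintro rfl
    exact hne (hC1.trans hC2.symm)
  rw [hC1] at h1
  rw [hC2] at h2
  rw [hC1, hC2]
  rcases lt_or_gt_of_ne hab with h | h
  · exact he.frontier_eq_of_strip hLcl hL hint hd h h1 h2
  · rw [union_comm]
    exact he.frontier_eq_of_strip hLcl hL hint hd h h2 h1

end IsModel

theorem subset_of_mem_bdryComponents {L C : Set X} (hC : C ∈ bdryComponents L) :
    C ⊆ frontier L := by
  obtain ⟨x, -, rfl⟩ := hC
  exact connectedComponentIn_subset _ _

theorem bdryComponents_eq_of_mem {L C C' : Set X} (hC : C ∈ bdryComponents L)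
    (hC' : C' ∈ bdryComponents L) {y : X} (hy : y ∈ C) (hy' : y ∈ C') : C = C' := by
  obtain ⟨x, -, rfl⟩ := hC
  obtain ⟨x', -, rfl⟩ := hC'
  rw [connectedComponentIn_eq hy, connectedComponentIn_eq hy']

theorem exists_mem_bdryComponents {L : Set X} {y : X} (hy : y ∈ frontier L) :
    ∃ C ∈ bdryComponents L, y ∈ C :=
  ⟨_, mem_image_of_mem _ hy, mem_connectedComponentIn hy⟩

theorem mink_lt_of_mem_interior {e : X → MinkSpace} {L : Set X} {n : MinkSpace} {t : ℝ}
    (hCF : {x | mink 2 (e x) n = t} ⊆ frontier L) (hle : ∀ y ∈ L, mink 2 (e y) n ≤ t) {p : X}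
    (hp : p ∈ interior L) : mink 2 (e p) n < t :=
  lt_of_le_of_ne (hle p (interior_subset hp)) fun h => (hCF h).2 hp

namespace IsModel

variable {e : X → MinkSpace} (he : IsModel e)
include he

/-- Each boundary component is a level set of a supporting unit normal. -/
theorem exists_support {L : Set X} (hL : GConvex L) (hint : (interior L).Nonempty)
    {C : Set X} (hCF : C ⊆ frontier L) (hC : IsHypercycleOrLine C) :
    ∃ n t, mink 2 n n = 1 ∧ C = {x | mink 2 (e x) n = t} ∧ ∀ y ∈ L, mink 2 (e y) n ≤ t := by
  obtain ⟨B, hB⟩ := exists_base hC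
  obtain ⟨d, t, hd, -, rfl, -⟩ := he.hypercycleWithBase_iff.1 hB
  rcases he.one_sided hL hint hCF with h | h
  · exact ⟨d, t, hd, rfl, h⟩
  · refine ⟨-d, -t, by simpa using hd, ?_, fun y hy => ?_⟩
    · ext x; simp
    · simpa using h y hy

theorem not_lt_of_combo {L : Set X} (hL : GConvex L) {p z y₁ y₂ : X} (hp : p ∈ interior L)
    (hy₁ : y₁ ∈ frontier L) (hy₂ : y₂ ∈ L) {α₁ β₁ α₂ β₂ : ℝ} (hβ₁ : 0 < β₁) (hβ₂ : 0 < β₂)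
    (h₁ : e y₁ = α₁ • e p + β₁ • e z) (h₂ : e y₂ = α₂ • e p + β₂ • e z) :
    ¬ β₁ * α₂ < β₂ * α₁ := by
  intro h
  refine hy₁.2 (he.mem_interior_of_combo hL (α := α₁ - β₁ * α₂ / β₂) (β := β₁ / β₂) hp hy₂ ?_
    (by positivity) ?_)
  · rw [sub_pos, div_lt_iff₀ hβ₂]
    linarith
  · rw [h₁, h₂]
    have := hβ₂.ne'
    match_scalars
    · field_simp
      ring
    · field_simp

theorem eq_of_support_inter {L : Set X} (hLcl : IsClosed L) (hL : GConvex L)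
    (hint : (interior L).Nonempty) {n n' : MinkSpace} {t t' : ℝ}
    (hC : {x | mink 2 (e x) n = t} ⊆ frontier L) (hle : ∀ y ∈ L, mink 2 (e y) n ≤ t)
    (hC' : {x | mink 2 (e x) n' = t'} ⊆ frontier L) (hle' : ∀ y ∈ L, mink 2 (e y) n' ≤ t')
    {z : X} (hz : t < mink 2 (e z) n) (hz' : t' < mink 2 (e z) n') :
    ∃ y, mink 2 (e y) n = t ∧ mink 2 (e y) n' = t' := by
  obtain ⟨p, hp⟩ := hint
  obtain ⟨y₁, α₁, β₁, hα₁, hβ₁, h₁, h₁'⟩ := he.exists_combo_eq_zero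
    (f := fun x => mink 2 (e x) n - t) ((he.continuous_mink_e n).sub continuous_const)
    (sub_neg.2 (mink_lt_of_mem_interior hC hle hp)) (sub_pos.2 hz)
  obtain ⟨y₂, α₂, β₂, hα₂, hβ₂, h₂, h₂'⟩ := he.exists_combo_eq_zero
    (f := fun x => mink 2 (e x) n' - t') ((he.continuous_mink_e n').sub continuous_const)
    (sub_neg.2 (mink_lt_of_mem_interior hC' hle' hp)) (sub_pos.2 hz')
  have hy₁ := hC (sub_eq_zero.1 h₁')
  have hy₂ := hC' (sub_eq_zero.1 h₂')
  have e1 := he.not_lt_of_combo hL hp hy₁ (hLcl.frontier_subset hy₂) hβ₁ hβ₂ h₁ h₂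
  have e2 := he.not_lt_of_combo hL hp hy₂ (hLcl.frontier_subset hy₁) hβ₂ hβ₁ h₂ h₁
  have heq : β₁ * α₂ = β₂ * α₁ := le_antisymm (not_lt.1 e2) (not_lt.1 e1)
  have hpar : e y₁ = (β₁ / β₂) • e y₂ := by
    rw [h₁, h₂]
    have := hβ₂.ne'
    match_scalars
    · field_simp
      linarith
    · field_simp
  have hs := he.mink_self y₁
  rw [hpar] at hs
  simp only [mink_smul_left, mink_smul_right, he.mink_self] at hs
  have hc : 0 < β₁ / β₂ := by positivity
  have hc1 : β₁ / β₂ = 1 := by nlinarith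
  rw [hc1, one_smul] at hpar
  obtain rfl := he.inj hpar
  exact ⟨y₁, sub_eq_zero.1 h₁', sub_eq_zero.1 h₂'⟩

theorem countable_bdryComponents {L : Set X} (hLcl : IsClosed L) (hL : GConvex L)
    (hint : (interior L).Nonempty) (hbd : BdryHypOrLine L) : (bdryComponents L).Countable := by
  have := he.secondCountableTopology
  have hex : ∀ C ∈ bdryComponents L, ∃ n t, mink 2 n n = 1 ∧ C = {x | mink 2 (e x) n = t} ∧
      ∀ y ∈ L, mink 2 (e y) n ≤ t := by
    rintro C ⟨x, hx, rfl⟩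
    exact he.exists_support hL hint (connectedComponentIn_subset _ _) (hbd x hx)
  choose! n t hn hC hle using hex
  refine Set.PairwiseDisjoint.countable_of_isOpen (s := fun C => {x | t C < mink 2 (e x) (n C)})
    ?_ (fun C _ => isOpen_lt continuous_const (he.continuous_mink_e _)) fun C h => ?_
  · intro C h C' h' hne
    refine Set.disjoint_left.2 fun z hz hz' => hne ?_
    obtain ⟨y, hy, hy'⟩ := he.eq_of_support_inter hLcl hL hint
      ((hC C h).symm.subset.trans (subset_of_mem_bdryComponents h)) (hle C h)
      ((hC C' h').symm.subset.trans (subset_of_mem_bdryComponents h')) (hle C' h') hz hz'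
    exact bdryComponents_eq_of_mem h h' ((hC C h).symm.subset hy) ((hC C' h').symm.subset hy')
  · obtain ⟨x, hx⟩ := he.exists_mink_eq (hn C h) (t C + 1)
    exact ⟨x, show t C < mink 2 (e x) (n C) by linarith⟩

end IsModel

theorem orientationPreserving_refl : OrientationPreserving (IsometryEquiv.refl X) :=
  ⟨[], by simp⟩

/-- A parabola through `u` avoids any fixed plane except at finitely many parameters. -/
theorem finite_parabola {u w : MinkSpace} (hu : u ∈ futureCone) (hw : w ≠ 0) :
    {τ : ℝ | mink 2 (u + τ • (!₂[1, 0], (0 : ℝ)) + τ ^ 2 • (!₂[0, 1], (0 : ℝ))) w = 0}.Finite := by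
  set p : Polynomial ℝ := Polynomial.C (mink 2 u w) + Polynomial.C (w.1 0) * Polynomial.X +
    Polynomial.C (w.1 1) * Polynomial.X ^ 2 with hp
  have hp0 : p ≠ 0 := by
    intro h
    have h0 : p.coeff 0 = 0 := by rw [h, Polynomial.coeff_zero]
    have h1 : p.coeff 1 = 0 := by rw [h, Polynomial.coeff_zero]
    have h2 : p.coeff 2 = 0 := by rw [h, Polynomial.coeff_zero]
    simp [hp, Polynomial.coeff_X, Polynomial.coeff_C] at h0 h1 h2
    have hu2 : 0 < u.2 := hu.2
    refine hw (MinkSpace.ext' h1 h2 ?_)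
    rw [mink_eq, h1, h2] at h0
    simpa [hu2.ne'] using h0
  refine (Polynomial.finite_setOfPred_isRoot hp0).subset fun τ hτ => ?_
  have : mink 2 (u + τ • (!₂[1, 0], (0 : ℝ)) + τ ^ 2 • (!₂[0, 1], (0 : ℝ))) w = 0 := hτ
  show p.IsRoot τ
  rw [Polynomial.IsRoot, ← this, hp]
  simp [mink_eq]
  ring

namespace IsModel

variable {e : X → MinkSpace} (he : IsModel e)
include he

theorem exists_unit_orth (c : X) : ∃ d : MinkSpace, mink 2 d d = 1 ∧ mink 2 (e c) d = 0 := by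
  set f : MinkSpace := (!₂[1, 0], 0)
  have hf : mink 2 f f = 1 := by simp [mink_eq, f]
  set a := mink 2 f (e c) with ha
  have hq : mink 2 (f + a • e c) (f + a • e c) = 1 + a ^ 2 := by
    simp only [mink_add_left, mink_add_right, mink_smul_left, mink_smul_right, he.mink_self,
      mink_comm (e c) f, hf, ← ha]
    ring
  have hpos : 0 < 1 + a ^ 2 := by positivity
  refine ⟨(√(1 + a ^ 2))⁻¹ • (f + a • e c), ?_, ?_⟩
  · rw [mink_smul_left, mink_smul_right, hq]
    have := Real.mul_self_sqrt hpos.le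
    have := (Real.sqrt_pos.2 hpos).ne'
    field_simp
    linarith
  · simp only [mink_add_right, mink_smul_right, he.mink_self, mink_comm (e c) f, ← ha]
    ring

theorem exists_orientationPreserving_map (o c : X) :
    ∃ φ : X ≃ᵢ X, OrientationPreserving φ ∧ φ o = c := by
  rcases eq_or_ne o c with rfl | hne
  · exact ⟨IsometryEquiv.refl X, orientationPreserving_refl, rfl⟩
  have hk : mink 2 (e o) (e c) < -1 :=
    lt_of_le_of_ne (he.mink_le o c) fun h => hne (he.eq_of_mink_eq h)
  have hpos : 0 < -2 - 2 * mink 2 (e o) (e c) := by linarith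
  set N := √(-2 - 2 * mink 2 (e o) (e c)) with hN
  have hNpos : 0 < N := Real.sqrt_pos.2 hpos
  have hNsq : N * N = -2 - 2 * mink 2 (e o) (e c) := Real.mul_self_sqrt hpos.le
  obtain ⟨σ, hσ⟩ := he.exists_reflectionMap (d := N⁻¹ • (e c - e o)) (by
    simp only [mink_smul_left, mink_smul_right, mink_sub_left, mink_sub_right, he.mink_self,
      mink_comm (e c) (e o)]
    field_simp
    linarith)
  obtain ⟨d, hd, hcd⟩ := he.exists_unit_orth c
  obtain ⟨ρ, hρ⟩ := he.exists_reflectionMap hd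
  refine ⟨[σ, ρ].foldr IsometryEquiv.trans (IsometryEquiv.refl X), ⟨[σ, ρ], ?_, ⟨1, rfl⟩, rfl⟩, ?_⟩
  · intro s hs
    simp only [List.mem_cons, List.not_mem_nil, or_false] at hs
    rcases hs with rfl | rfl
    · exact he.isReflection_of_vector (by
        simp only [mink_smul_left, mink_smul_right, mink_sub_left, mink_sub_right, he.mink_self,
          mink_comm (e c) (e o)]
        field_simp
        linarith) hσ
    · exact he.isReflection_of_vector hd hρ
  · have h1 : σ o = c := by
      apply he.inj
      rw [hσ, smul_smul]
      simp only [mink_smul_right, mink_sub_right, he.mink_self]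
      have : 2 * (N⁻¹ * (mink 2 (e o) (e c) - -1)) * N⁻¹ = -1 := by
        field_simp
        linarith
      rw [this]
      simp
    have h2 : ρ c = c := by
      apply he.inj
      rw [hρ, hcd]
      simp
    show ρ (σ o) = c
    rw [h1, h2]

theorem exists_generic {c₀ : X} {U : Set X} (hU : U ∈ nhds c₀) {W : Set MinkSpace}
    (hW : W.Countable) (h0 : (0 : MinkSpace) ∉ W) : ∃ c ∈ U, ∀ w ∈ W, mink 2 (e c) w ≠ 0 := by
  set g : ℝ → MinkSpace := fun τ =>
    e c₀ + τ • (!₂[1, 0], (0 : ℝ)) + τ ^ 2 • (!₂[0, 1], (0 : ℝ)) with hg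
  have hgc : Continuous g := by fun_prop
  have hg0 : g 0 = e c₀ := MinkSpace.ext' (by simp [hg]) (by simp [hg]) (by simp [hg])
  have hcone : g ⁻¹' futureCone ∈ nhds (0 : ℝ) :=
    hgc.continuousAt.preimage_mem_nhds
      (by rw [hg0]; exact isOpen_futureCone.mem_nhds (he.mem_futureCone c₀))
  have hUn : (fun τ => he.proj (g τ)) ⁻¹' U ∈ nhds (0 : ℝ) := by
    refine ContinuousAt.preimage_mem_nhds (ContinuousAt.comp (g := he.proj) ?_ hgc.continuousAt) ?_
    · rw [hg0]
      exact he.continuousAt_proj (he.mem_futureCone c₀)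
    · rwa [hg0, he.proj_e]
  have hcount : (⋃ w ∈ W, {τ : ℝ | mink 2 (g τ) w = 0}).Countable :=
    hW.biUnion fun w hw => (finite_parabola (he.mem_futureCone c₀)
      fun h => h0 (h ▸ hw)).countable
  obtain ⟨τ, hτ, h1, h2⟩ :=
    (hcount.dense_compl ℝ).inter_nhds_nonempty (inter_mem hcone hUn)
  refine ⟨_, h2, fun w hw h => hτ (mem_biUnion hw ?_)⟩
  obtain ⟨k, hk, hk'⟩ := he.exists_proj_eq h1
  rw [hk', mink_smul_left] at h
  exact (mul_eq_zero.1 h).resolve_left hk.ne'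

end IsModel

theorem mem_frontier_inter {A B : Set X} {z : X} (hA : z ∈ frontier A) (hB : z ∈ interior B) :
    z ∈ frontier (A ∩ B) := by
  have h := frontier_inter_open_inter (s := A ∩ B) (t := interior B) isOpen_interior
  rw [inter_assoc, inter_eq_right.2 interior_subset, frontier_inter_open_inter isOpen_interior] at h
  exact (h.subset ⟨hA, hB⟩).1

theorem not_countable_inter_of_subset {α : Type*} {S A : Set α} {F : Set (Set α)} (hF : F.Countable)
    (hS : ¬ S.Countable) (hsub : S ⊆ A ∪ ⋃₀ F) :
    ¬ (S ∩ A).Countable ∨ ∃ C ∈ F, ¬ (S ∩ C).Countable := by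
  by_contra! h
  refine hS ((h.1.union (hF.biUnion h.2)).mono fun x hx => ?_)
  rcases hsub hx with hA | ⟨C, hC, hxC⟩
  · exact Or.inl ⟨hx, hA⟩
  · exact Or.inr (mem_biUnion hC ⟨hx, hxC⟩)

theorem not_countable_image {S : Set X} (hS : ¬ S.Countable) (σ : X ≃ᵢ X) :
    ¬ (σ '' S).Countable :=
  fun h => hS (countable_of_injective_of_countable_image σ.injective.injOn h)

theorem frontier_closedBall_inter_subset (L : Set X) (c : X) (r : ℝ) :
    frontier (closedBall c r ∩ L) ⊆ sphere c r ∪ frontier L := by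
  refine (frontier_inter_subset _ _).trans (union_subset_union ?_ ?_)
  · exact inter_subset_left.trans frontier_closedBall_subset_sphere
  · exact inter_subset_right

theorem frontier_subset_sUnion (L : Set X) : frontier L ⊆ ⋃₀ bdryComponents L := fun _ hy => by
  obtain ⟨C, hC, hyC⟩ := exists_mem_bdryComponents hy
  exact ⟨C, hC, hyC⟩

namespace IsModel

variable {e : X → MinkSpace} (he : IsModel e)
include he

theorem exists_mid {x y : X} {r : ℝ} (hxy : dist x y < 2 * r) :
    ∃ c, dist x c < r ∧ dist y c < r := by
  have hr : 0 ≤ r := by linarith [dist_nonneg (x := x) (y := y)]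
  set h := dist x y / 2 with hh
  have hk : mink 2 (e x) (e y) = 1 - 2 * Real.cosh h ^ 2 := by
    have h1 := he.cosh_dist x y
    rw [show dist x y = 2 * h by rw [hh]; ring, Real.cosh_two_mul, Real.sinh_sq] at h1
    linarith
  have hcp := Real.cosh_pos h
  have hcone : e x + e y ∈ futureCone :=
    add_mem_futureCone (he.mem_futureCone x) (he.mem_futureCone y)
  have hs : √(-mink 2 (e x + e y) (e x + e y)) = 2 * Real.cosh h := by
    rw [Real.sqrt_eq_iff_mul_self_eq_of_pos (by positivity)]
    simp only [mink_add_left, mink_add_right, he.mink_self, mink_comm (e y) (e x), hk]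
    ring
  have hlt : Real.cosh h < Real.cosh r := by
    rw [Real.cosh_lt_cosh, abs_of_nonneg (by positivity), abs_of_nonneg hr]
    linarith
  refine ⟨he.proj (e x + e y), ?_, ?_⟩
  · rw [dist_comm, he.dist_lt_iff hr, he.mink_proj hcone, hs, mink_add_left, he.mink_self,
      mink_comm (e y), hk]
    refine lt_of_eq_of_lt ?_ hlt
    field_simp
    ring
  · rw [dist_comm, he.dist_lt_iff hr, he.mink_proj hcone, hs, mink_add_left, he.mink_self, hk]
    refine lt_of_eq_of_lt ?_ hlt
    field_simp
    ring

theorem mem_sphere_iff {c x : X} {r : ℝ} (hr : 0 ≤ r) :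
    x ∈ sphere c r ↔ mink 2 (e x) (e c) = -Real.cosh r := by
  rw [mem_sphere, he.dist_eq_iff hr, neg_eq_iff_eq_neg]

theorem frontier_closedBall_eq {c : X} {r : ℝ} (hr : 0 < r) :
    frontier (closedBall c r) = sphere c r := by
  have h := he.frontier_sublevel (w := -e c) (t := Real.cosh r) (Real.cosh_pos r).le
    (Or.inr ⟨by simp [he.mink_self], Real.one_lt_cosh.2 hr.ne'⟩)
  convert h using 2
  · ext x
    simp [he.dist_le_iff hr.le]
  · ext x
    rw [he.mem_sphere_iff hr.le]
    simp [neg_eq_iff_eq_neg]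

theorem exists_sphere_interior {L : Set X} (hL : GConvex L) (hint : (interior L).Nonempty)
    {c x y : X} {r : ℝ} (hx : x ∈ L) (hxc : dist x c < r) (hy : y ∈ L) (hyc : r < dist y c) :
    ∃ z ∈ interior L, dist z c = r := by
  have hcl := he.subset_closure_interior hL hint
  obtain ⟨x', hx', hx'L⟩ := mem_closure_iff.1 (hcl hx) {u | dist u c < r}
    (isOpen_lt (continuous_id.dist continuous_const) continuous_const) hxc
  obtain ⟨y', hy', hy'L⟩ := mem_closure_iff.1 (hcl hy) {u | r < dist u c}
    (isOpen_lt continuous_const (continuous_id.dist continuous_const)) hyc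
  obtain ⟨z, α, β, hα, hβ, hz, hz0⟩ := he.exists_combo_eq_zero (f := fun u => dist u c - r)
    ((continuous_id.dist continuous_const).sub continuous_const) (sub_neg.2 hx') (sub_pos.2 hy')
  exact ⟨z, he.mem_interior_of_combo hL hx'L (interior_subset hy'L) hα hβ.le hz, sub_eq_zero.1 hz0⟩

/-- A congruence preserving a truncated disc whose boundary consists of an uncountable
piece of the circle and pieces of lines and hypercycles fixes the centre of the disc. -/
theorem fixes_center {L : Set X} (hcount : (bdryComponents L).Countable)
    (hC : ∀ C ∈ bdryComponents L, ∃ n t, mink 2 n n = 1 ∧ C = {x | mink 2 (e x) n = t})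
    {c : X} {r : ℝ} (hr : 0 < r) (hz : ∃ z ∈ interior L, dist z c = r) {σ : X ≃ᵢ X}
    (hσ : σ '' (closedBall c r ∩ L) = closedBall c r ∩ L) : σ c = c := by
  obtain ⟨z, hzL, hzc⟩ := hz
  have hzm := (he.mem_sphere_iff hr.le).1 (mem_sphere.2 hzc)
  have h1 := Real.one_lt_cosh.2 hr.ne'
  have hunc := not_countable_image (he.not_countable_level (w := e c) (z := z)
    (Or.inr ⟨he.mink_self c, by rw [hzm]; nlinarith⟩) (isOpen_interior.mem_nhds hzL)) σ
  have hval : ∀ y ∈ σ '' ({x | mink 2 (e x) (e c) = mink 2 (e z) (e c)} ∩ interior L),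
      mink 2 (e y) (e (σ c)) = -Real.cosh r := by
    rintro _ ⟨x, ⟨hx, -⟩, rfl⟩
    rw [he.mink_isometry, ← hzm]
    exact hx
  have hsub : σ '' ({x | mink 2 (e x) (e c) = mink 2 (e z) (e c)} ∩ interior L) ⊆
      sphere c r ∪ ⋃₀ bdryComponents L := by
    refine Subset.trans ?_ ((frontier_closedBall_inter_subset L c r).trans
      (union_subset_union_right _ (frontier_subset_sUnion L)))
    rw [← hσ, ← IsometryEquiv.coe_toHomeomorph, ← Homeomorph.image_frontier]
    refine image_mono fun x hx => mem_frontier_inter ?_ hx.2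
    rw [he.frontier_closedBall_eq hr, he.mem_sphere_iff hr.le, ← hzm]
    exact hx.1
  rcases not_countable_inter_of_subset hcount hunc hsub with h | ⟨C, hCm, h⟩
  · have hcr := he.cross_eq_zero_of_uncountable h (fun y hy => hval y hy.1)
      (fun y hy => (he.mem_sphere_iff hr.le).1 hy.2)
    obtain ⟨k, hk⟩ := parallel_of_cross_eq_zero hcr (fun h0 => by
      simpa [h0, mink_eq] using he.mink_self (σ c))
    have h2 := he.mink_self c
    have h3 := he.mink_le c (σ c)
    rw [hk] at h2
    rw [hk] at h3
    simp only [mink_smul_left, mink_smul_right, he.mink_self] at h2 h3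
    refine (he.eq_of_mink_eq (x := c) ?_).symm
    rw [hk, mink_smul_left, he.mink_self]
    nlinarith
  · obtain ⟨n, t, hn, rfl⟩ := hC C hCm
    have hcr := he.cross_eq_zero_of_uncountable h (fun y hy => hval y hy.1) (fun y hy => hy.2)
    obtain ⟨k, rfl⟩ := parallel_of_cross_eq_zero hcr (fun h0 => by
      simpa [h0, mink_eq] using he.mink_self (σ c))
    simp only [mink_smul_left, mink_smul_right, he.mink_self] at hn
    nlinarith [sq_nonneg k]

theorem hypercycleWithBase_level {n : MinkSpace} (hn : mink 2 n n = 1) (t : ℝ) :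
    HypercycleWithBase {x | mink 2 (e x) n = t} {x | mink 2 (e x) n = 0} := by
  rw [he.hypercycleWithBase_iff]
  rcases le_total 0 t with ht | ht
  · exact ⟨n, t, hn, ht, rfl, rfl⟩
  · exact ⟨-n, -t, by simpa using hn, by linarith, by ext; simp, by ext; simp⟩

/-- A congruence preserving a truncated disc and fixing its centre permutes the normals of
those boundary components that meet the open disc. -/
theorem exists_map_normal {L : Set X} (hcount : (bdryComponents L).Countable) {n : Set X → MinkSpace} {t : Set X → ℝ}
    (hn : ∀ C ∈ bdryComponents L, mink 2 (n C) (n C) = 1)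
    (hC : ∀ C ∈ bdryComponents L, C = {x | mink 2 (e x) (n C) = t C})
    (hle : ∀ C ∈ bdryComponents L, ∀ y ∈ L, mink 2 (e y) (n C) ≤ t C)
    {c : X} {r : ℝ} (hint : (ball c r ∩ interior L).Nonempty) {σ : X ≃ᵢ X}
    (hσ : σ '' (closedBall c r ∩ L) = closedBall c r ∩ L) (hσc : σ c = c)
    {T : MinkSpace →ₗ[ℝ] MinkSpace} (hT : ∀ u v, mink 2 (T u) (T v) = mink 2 u v)
    (hTe : ∀ x, T (e x) = e (σ x)) {C : Set X} (hCm : C ∈ bdryComponents L)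
    (hCb : (C ∩ ball c r).Nonempty) : ∃ D ∈ bdryComponents L, n D = T (n C) := by
  obtain ⟨x, hxC, hxb⟩ := hCb
  have hxn : mink 2 (e x) (n C) = t C := (hC C hCm).subset hxC
  have hunc := not_countable_image (he.not_countable_level (w := n C) (z := x)
    (Or.inl (hn C hCm)) (isOpen_ball.mem_nhds hxb)) σ
  have hval : ∀ y ∈ σ '' ({z | mink 2 (e z) (n C) = mink 2 (e x) (n C)} ∩ ball c r),
      mink 2 (e y) (T (n C)) = t C := by
    rintro _ ⟨z, ⟨hz, -⟩, rfl⟩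
    rw [← hTe, hT, ← hxn]
    exact hz
  have hsub : σ '' ({z | mink 2 (e z) (n C) = mink 2 (e x) (n C)} ∩ ball c r) ⊆
      ∅ ∪ ⋃₀ bdryComponents L := by
    rintro _ ⟨z, ⟨hz, hzb⟩, rfl⟩
    have hzC : z ∈ C := (hC C hCm).symm.subset (hz.trans hxn)
    have h1 : z ∈ frontier (closedBall c r ∩ L) := by
      rw [inter_comm]
      exact mem_frontier_inter (subset_of_mem_bdryComponents hCm hzC)
        (ball_subset_interior_closedBall hzb)
    have h2 : σ z ∈ frontier (closedBall c r ∩ L) := by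
      rw [← hσ, ← IsometryEquiv.coe_toHomeomorph, ← Homeomorph.image_frontier]
      exact mem_image_of_mem _ h1
    rcases frontier_closedBall_inter_subset L c r h2 with h | h
    · rw [mem_sphere, ← hσc, σ.dist_eq] at h
      exact absurd h (mem_ball.1 hzb).ne
    · exact Or.inr (frontier_subset_sUnion L h)
  obtain ⟨D, hD, h⟩ := (not_countable_inter_of_subset hcount hunc hsub).resolve_left (by simp)
  have hDn : ∀ y ∈ D, mink 2 (e y) (n D) = t D := fun y hy => (hC D hD).subset hy
  refine ⟨D, hD, ?_⟩
  obtain ⟨k, hk⟩ := parallel_of_cross_eq_zero (he.cross_eq_zero_of_uncountable h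
    (fun y hy => hval y hy.1) (fun y hy => hDn y hy.2)) (fun h0 => by
      have := hT (n C) (n C)
      rw [h0, hn C hCm] at this
      simp [mink_eq] at this)
  have hk2 : (k - 1) * (k + 1) = 0 := by
    have := hn D hD
    rw [hk] at this
    simp only [mink_smul_left, mink_smul_right, hT, hn C hCm] at this
    linarith
  rcases mul_eq_zero.1 hk2 with hk1 | hk1
  · rw [hk, sub_eq_zero.1 hk1, one_smul]
  · exfalso
    obtain rfl : k = -1 := by linarith
    have hneg : ∀ y, mink 2 (e y) (T (n C)) = -mink 2 (e y) (n D) := fun y => by simp [hk]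
    obtain ⟨y, hy⟩ : (σ '' ({z | mink 2 (e z) (n C) = mink 2 (e x) (n C)} ∩ ball c r) ∩ D).Nonempty :=
      nonempty_iff_ne_empty.2 fun h0 => h (by simp [h0])
    have ht : t C = -t D := by rw [← hval y hy.1, hneg, hDn y hy.2]
    obtain ⟨p, hpb, hpL⟩ := hint
    have hp : p ∈ σ '' (closedBall c r ∩ L) := by
      rw [hσ]
      exact ⟨ball_subset_closedBall hpb, interior_subset hpL⟩
    have hlt := mink_lt_of_mem_interior
      ((hC D hD).symm.subset.trans (subset_of_mem_bdryComponents hD)) (hle D hD) hpL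
    obtain ⟨q, ⟨-, hq⟩, rfl⟩ := hp
    have h3 := hle C hCm q hq
    rw [← hT, hTe, hneg] at h3
    linarith

theorem eq_refl_of_fixes {c : X} {σ : X ≃ᵢ X} (hσc : σ c = c) {T : MinkSpace →ₗ[ℝ] MinkSpace}
    (hT : ∀ u v, mink 2 (T u) (T v) = mink 2 u v) (hTe : ∀ x, T (e x) = e (σ x))
    {n m : MinkSpace} (hn : T n = n) (hm : T m = m) (hc : mink 2 (e c) (cross n m) ≠ 0) :
    σ = IsometryEquiv.refl X := by
  refine IsometryEquiv.ext fun z => he.inj (sub_eq_zero.1 ?_)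
  have key : ∀ w, T w = w → mink 2 (e (σ z) - e z) w = 0 := fun w hw => by
    rw [mink_sub_left, ← hTe]
    nth_rw 1 [← hw]
    rw [hT, sub_self]
  exact eq_zero_of_mink_eq_zero (by rwa [mink_comm]) (key n hn) (key m hm)
    (key (e c) (by rw [hTe, hσc]))

theorem two_mul_le_dist {L : Set X} (hLcl : IsClosed L) (hL : GConvex L)
    (hint : (interior L).Nonempty) (hbd : BdryHypOrLine L) {r : ℝ} (hr : 0 < r)
    (hcong : ∀ c, (interior (closedBall c r ∩ L)).Nonempty →
      AdmitsNontrivialCongruence (closedBall c r ∩ L))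
    {C₁ C₂ : Set X} (hC₁ : C₁ ∈ bdryComponents L) (hC₂ : C₂ ∈ bdryComponents L)
    (hbase : ∀ B, HypercycleWithBase C₁ B → ¬ HypercycleWithBase C₂ B) {x y : X} (hx : x ∈ C₁)
    (hy : y ∈ C₂) : 2 * r ≤ dist x y := by
  by_contra! hxy
  have hcount := he.countable_bdryComponents hLcl hL hint hbd
  have hex : ∀ C ∈ bdryComponents L, ∃ n t, mink 2 n n = 1 ∧ C = {x | mink 2 (e x) n = t} ∧
      ∀ y ∈ L, mink 2 (e y) n ≤ t := by
    rintro C ⟨x, hx, rfl⟩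
    exact he.exists_support hL hint (connectedComponentIn_subset _ _) (hbd x hx)
  choose! n t hn hC hle using hex
  have hcross : cross (n C₁) (n C₂) ≠ 0 := by
    intro h0
    obtain ⟨k, hk⟩ := parallel_of_cross_eq_zero h0 (fun h => by
      simpa [h, mink_eq] using hn C₁ hC₁)
    have hk0 : k ≠ 0 := by
      rintro rfl
      simpa [hk, mink_eq] using hn C₂ hC₂
    refine hbase {x | mink 2 (e x) (n C₁) = 0} ?_ ?_
    · have h1 := he.hypercycleWithBase_level (hn C₁ hC₁) (t C₁)
      rwa [← hC C₁ hC₁] at h1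
    · have h2 := he.hypercycleWithBase_level (hn C₂ hC₂) (t C₂)
      rw [← hC C₂ hC₂] at h2
      convert h2 using 3
      simp [hk, hk0]
  obtain ⟨c₀, hxc₀, hyc₀⟩ := he.exists_mid hxy
  have hU : {c | dist x c < r} ∩ {c | dist y c < r} ∈ nhds c₀ :=
    ((isOpen_lt (continuous_const.dist continuous_id) continuous_const).inter
      (isOpen_lt (continuous_const.dist continuous_id) continuous_const)).mem_nhds ⟨hxc₀, hyc₀⟩
  obtain ⟨c, ⟨hxc, hyc⟩, hgen⟩ := he.exists_generic hU
    (W := (insert (cross (n C₁) (n C₂)) (image2 (fun C D => n C - n D) (bdryComponents L)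
      (bdryComponents L))) \ {0})
    (((hcount.image2 hcount _).insert _).mono sdiff_subset) (fun h => h.2 rfl)
  have hxc : dist x c < r := hxc
  have hyc : dist y c < r := hyc
  have hCL : ∀ C ∈ bdryComponents L, C ⊆ L := fun C h =>
    (subset_of_mem_bdryComponents h).trans hLcl.frontier_subset
  have hbi : (ball c r ∩ interior L).Nonempty :=
    mem_closure_iff.1 (he.subset_closure_interior hL hint (hCL C₁ hC₁ hx)) _ isOpen_ball hxc
  obtain ⟨σ, hσ1, hσ⟩ := hcong c (by
    rw [interior_inter]
    exact hbi.mono (inter_subset_inter_left _ ball_subset_interior_closedBall))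
  obtain ⟨T, hT, hTe⟩ := he.exists_linear σ
  have hσc : σ c = c := by
    refine he.fixes_center hcount (fun C h => ⟨n C, t C, hn C h, hC C h⟩) hr ?_ hσ
    obtain ⟨y', hy', hfar⟩ := he.exists_far_level (hn C₁ hC₁) x (r + r)
    have hy'C : y' ∈ C₁ := (hC C₁ hC₁).symm.subset (hy'.trans ((hC C₁ hC₁).subset hx))
    refine he.exists_sphere_interior hL hint (hCL C₁ hC₁ hx) hxc (hCL C₁ hC₁ hy'C) ?_
    linarith [dist_triangle x c y', dist_comm c y']
  have hfix : ∀ C ∈ bdryComponents L, (C ∩ ball c r).Nonempty → T (n C) = n C := by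
    intro C h hb
    obtain ⟨D, hD, hDn⟩ := he.exists_map_normal hcount hn hC hle hbi hσ hσc hT hTe h hb
    rw [← hDn]
    by_contra hne
    refine hgen (n D - n C) ⟨Or.inr (mem_image2_of_mem hD h), sub_ne_zero.2 hne⟩ ?_
    rw [mink_sub_right, hDn, ← hT (e c) (n C), hTe, hσc, sub_self]
  exact hσ1 (he.eq_refl_of_fixes hσc hT hTe (hfix C₁ hC₁ ⟨x, hx, hxc⟩) (hfix C₂ hC₂ ⟨y, hy, hyc⟩)
    (hgen _ ⟨mem_insert _ _, hcross⟩))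

end IsModel

/-- **Lemma 5.4.** In the hyperbolic plane, suppose every intersection of congruent
copies of `K`, `L` admits some non-trivial congruence, `K` is a circle of radius `r`
and centre `o`, and the connected boundary components of `L` are at least two
hypercycles or straight lines. Then case (B) or case (C) of Theorem 5 holds. -/
theorem lemma5_4
    (X : Type*) [MetricSpace X] (hX : IsHyperbolicSpace X 2)
    (K L : Set X)
    (hKcl : IsClosed K) (hLcl : IsClosed L)
    (hKcv : GConvex K) (hLcv : GConvex L)
    (hKint : (interior K).Nonempty) (hLint : (interior L).Nonempty)
    (hKpr : K ≠ univ) (hLpr : L ≠ univ)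
    (hcong : T5Cond1 K L)
    (o : X) (r : ℝ) (hr : 0 < r) (hK : K = closedBall o r)
    (hLbd : BdryHypOrLine L) (hLtwo : AtLeastTwoComponents L) :
    TwoHypSameBase L ∨ MultiHypFarApart L r := by
  obtain ⟨e, hinj, hrange, hcosh⟩ := hX
  have he : IsModel e := ⟨hinj, hrange, hcosh⟩
  by_cases hB : ∃ C₁ ∈ bdryComponents L, ∃ C₂ ∈ bdryComponents L, C₁ ≠ C₂ ∧
      ∃ B, HypercycleWithBase C₁ B ∧ HypercycleWithBase C₂ B
  · obtain ⟨C₁, h₁, C₂, h₂, hne, B, hB₁, hB₂⟩ := hB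
    exact Or.inl (he.twoHypSameBase_of_common_base hLcl hLcv hLint hne
      (subset_of_mem_bdryComponents h₁) (subset_of_mem_bdryComponents h₂) hB₁ hB₂)
  · have hB' : ∀ C₁ ∈ bdryComponents L, ∀ C₂ ∈ bdryComponents L, C₁ ≠ C₂ →
        ∀ B, HypercycleWithBase C₁ B → ¬ HypercycleWithBase C₂ B :=
      fun C₁ h₁ C₂ h₂ hne B hB₁ hB₂ => hB ⟨C₁, h₁, C₂, h₂, hne, B, hB₁, hB₂⟩
    refine Or.inr ⟨hLbd, hLtwo, fun x hx y hy hne => ?_⟩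
    have hxm := mem_image_of_mem (connectedComponentIn (frontier L)) hx
    have hym := mem_image_of_mem (connectedComponentIn (frontier L)) hy
    refine ⟨?_, fun B₁ B₂ h₁ h₂ hBB => hB' _ hxm _ hym hne B₁ h₁ (hBB ▸ h₂)⟩
    refine he.two_mul_le_dist hLcl hLcv hLint hLbd hr (fun c hc => ?_) hxm hym
      (hB' _ hxm _ hym hne) (mem_connectedComponentIn hx) (mem_connectedComponentIn hy)
    obtain ⟨φ, hφ, rfl⟩ := he.exists_orientationPreserving_map o c
    have h := hcong φ (IsometryEquiv.refl X) hφ orientationPreserving_refl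
    rw [hK, φ.image_closedBall, show ⇑(IsometryEquiv.refl X) = id from rfl, image_id] at h
    exact h hc

end BallChar
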